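/- Let D = D_h be a pseudoconvex balanced domain in ℂ² with h ≢ 0. Then the coordinate functions z ↦ z₁ and z ↦ z₂ both belong to L²_h(D_h) if and only if ν(log h,[v]) < 1/3 for every v ∈ ℂ² ∖ {0}. (This is equivalent to D_h admitting the Bergman metric.) -/

import Mathlib

open MeasureTheory Filter Topology
open scoped ENNReal NNReal

noncomputable section

/-- `f` belongs to the Bergman space `L²_h(D)`: holomorphic on `D` and square integrable. -/
def MemL2h {n : ℕ} (D : Set (Fin n → ℂ)) (f : (Fin n → ℂ) → ℂ) : Prop :=
  DifferentiableOn ℂ f D ∧ (∫⁻ z in D, (‖f z‖₊ : ℝ≥0∞) ^ 2) < ⊤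

/-- `h` is absolutely homogeneous. -/
def AbsHomog {n : ℕ} (h : (Fin n → ℂ) → ℝ) : Prop :=
  ∀ (c : ℂ) (z : Fin n → ℂ), h (c • z) = ‖c‖ * h z

/-- `log h` is plurisubharmonic (sub-mean value inequality on complex lines, where the
possibly `-∞`-valued integrand is handled via truncations `max · c`). -/
def LogPSH {n : ℕ} (h : (Fin n → ℂ) → ℝ) : Prop :=
  ∀ (a b : Fin n → ℂ) (r : ℝ), 0 < r → h a ≠ 0 → ∀ c : ℝ,
    Real.log (h a) ≤ (1 / (2 * Real.pi)) *
      ∫ θ in (0:ℝ)..(2 * Real.pi),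
        max (Real.log (h (a + ((r : ℂ) * Complex.exp (θ * Complex.I)) • b))) c

/-- `M_d(z)`: sup of `|P(z)|` over homogeneous polynomials `P` of degree `d` with
`∫_{D_h} |P|² dλ ≤ 1`. -/
def Md {n : ℕ} (h : (Fin n → ℂ) → ℝ) (d : ℕ) (z : Fin n → ℂ) : ℝ≥0∞ :=
  ⨆ (P : MvPolynomial (Fin n) ℂ) (_ : P.IsHomogeneous d)
    (_ : (∫⁻ w in {w | h w < 1}, (‖MvPolynomial.eval w P‖₊ : ℝ≥0∞) ^ 2) ≤ 1),
    (‖MvPolynomial.eval z P‖₊ : ℝ≥0∞)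

/-- `h_BK(z) = limsup_{d → ∞} M_d(z)^{1/d}`. -/
def hBK {n : ℕ} (h : (Fin n → ℂ) → ℝ) (z : Fin n → ℂ) : ℝ≥0∞ :=
  Filter.limsup (fun d : ℕ => (Md h d z) ^ (1 / (d : ℝ))) atTop

/-- Upper semicontinuous regularization of `h_BK`. -/
def hBKstar {n : ℕ} (h : (Fin n → ℂ) → ℝ) (z : Fin n → ℂ) : ℝ≥0∞ :=
  Filter.limsup (hBK h) (𝓝 z)

/-- The Bergman kernel of `D` on the diagonal. -/
def bergmanK {n : ℕ} (D : Set (Fin n → ℂ)) (z : Fin n → ℂ) : ℝ≥0∞ :=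
  ⨆ (f : (Fin n → ℂ) → ℂ) (_ : DifferentiableOn ℂ f D)
    (_ : (∫⁻ w in D, (‖f w‖₊ : ℝ≥0∞) ^ 2) ≤ 1), (‖f z‖₊ : ℝ≥0∞) ^ 2

/-- `D` is an `L²_h`-domain of holomorphy. -/
def IsL2hDomainOfHolomorphy {n : ℕ} (D : Set (Fin n → ℂ)) : Prop :=
  ¬ ∃ D₀ D₁ : Set (Fin n → ℂ), IsOpen D₀ ∧ IsOpen D₁ ∧ IsConnected D₀ ∧ IsConnected D₁ ∧
      D₀ ⊆ D₁ ∩ D ∧ ¬ (D₁ ⊆ D) ∧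
      ∀ f : (Fin n → ℂ) → ℂ, MemL2h D f →
        ∃ F : (Fin n → ℂ) → ℂ, DifferentiableOn ℂ F D₁ ∧ Set.EqOn F f D₀

/-- The Lelong number `ν(log h, [v])` of `log h` at the direction `[v] ∈ ℙ¹`. -/
def lelong (h : (Fin 2 → ℂ) → ℝ) (v : Fin 2 → ℂ) : ℝ :=
  if v 1 ≠ 0 then
    Filter.limsup (fun r : ℝ =>
      (⨆ θ : ℝ, Real.log (h ![v 0 + (r : ℂ) * Complex.exp (θ * Complex.I), v 1])) / Real.log r)
      (𝓝[>] 0)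
  else
    Filter.limsup (fun r : ℝ =>
      (⨆ θ : ℝ, Real.log (h ![v 0, (r : ℂ) * Complex.exp (θ * Complex.I)])) / Real.log r)
      (𝓝[>] 0)

/-- `m(Q,[v])`: the largest `k` such that `(v₂ z₁ - v₁ z₂)^k` divides `Q`. -/
def multAt (v : Fin 2 → ℂ) (Q : MvPolynomial (Fin 2) ℂ) : ℕ :=
  sSup {k : ℕ |
    (MvPolynomial.C (v 1) * MvPolynomial.X 0 - MvPolynomial.C (v 0) * MvPolynomial.X 1) ^ k ∣ Q}


/-- The logarithm of `f`, truncated below at `c`. -/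
def truncLog (f : ℂ → ℝ) (c : ℝ) (z : ℂ) : ℝ := Real.log (max (f z) (Real.exp c))

/-- Nonnegative functions on the plane, not identically zero, whose logarithm is subharmonic. -/
structure LogSubharmonic (f : ℂ → ℝ) : Prop where
  nonneg : ∀ z, 0 ≤ f z
  usc : UpperSemicontinuous f
  submean : ∀ (c : ℝ) (z : ℂ) (r : ℝ), 0 < r →
    truncLog f c z ≤ Real.circleAverage (truncLog f c) z r
  nontrivial : ∃ z, f z ≠ 0

lemma le_truncLog (f : ℂ → ℝ) (c : ℝ) (z : ℂ) : c ≤ truncLog f c z :=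
  (Real.le_log_iff_exp_le (lt_max_of_lt_right (Real.exp_pos c))).2 (le_max_right _ _)

lemma truncLog_le_iff {f : ℂ → ℝ} {c t : ℝ} {z : ℂ} :
    truncLog f c z ≤ t ↔ f z ≤ Real.exp t ∧ c ≤ t := by
  rw [truncLog, Real.log_le_iff_le_exp (lt_max_of_lt_right (Real.exp_pos c)), max_le_iff,
    Real.exp_le_exp]

lemma log_le_truncLog {f : ℂ → ℝ} {z : ℂ} (c : ℝ) (hz : 0 < f z) :
    Real.log (f z) ≤ truncLog f c z :=
  Real.log_le_log hz (le_max_left _ _)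

lemma truncLog_of_pos {f : ℂ → ℝ} {z : ℂ} (c : ℝ) (hz : 0 < f z) :
    truncLog f c z = max (Real.log (f z)) c := by
  apply le_antisymm
  · rw [truncLog_le_iff]
    refine ⟨?_, le_max_right _ _⟩
    calc f z = Real.exp (Real.log (f z)) := (Real.exp_log hz).symm
      _ ≤ _ := Real.exp_le_exp.2 (le_max_left _ _)
  · exact max_le (log_le_truncLog c hz) (le_truncLog f c z)

lemma truncLog_mono (f : ℂ → ℝ) {c d : ℝ} (h : c ≤ d) (z : ℂ) :
    truncLog f c z ≤ truncLog f d z := by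
  rw [truncLog_le_iff]
  exact ⟨(truncLog_le_iff.1 le_rfl).1, h.trans (le_truncLog f d z)⟩

lemma truncLog_upperSemicontinuous {f : ℂ → ℝ} (hf : UpperSemicontinuous f) (c : ℝ) :
    UpperSemicontinuous (truncLog f c) := by
  have hc : Continuous fun x : ℝ ↦ Real.log (max x (Real.exp c)) :=
    (continuous_id.max continuous_const).log
      fun x ↦ (lt_max_of_lt_right (Real.exp_pos c)).ne'
  refine hc.comp_upperSemicontinuous hf fun x y hxy ↦ ?_
  exact Real.log_le_log (lt_max_of_lt_right (Real.exp_pos c)) (max_le_max_right _ hxy)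

lemma truncLog_measurable {f : ℂ → ℝ} (hf : UpperSemicontinuous f) (c : ℝ) :
    Measurable (truncLog f c) :=
  (truncLog_upperSemicontinuous hf c).measurable

lemma exists_truncLog_le {f : ℂ → ℝ} (hf : UpperSemicontinuous f) {K : Set ℂ}
    (hK : IsCompact K) : ∃ B, 0 ≤ B ∧ ∀ c ≤ 0, ∀ z ∈ K, truncLog f c z ≤ B := by
  obtain ⟨M, hM⟩ := UpperSemicontinuousOn.bddAbove_of_isCompact hK
    ((truncLog_upperSemicontinuous hf 0).upperSemicontinuousOn K)
  refine ⟨max M 0, le_max_right _ _, fun c hc z hz ↦ ?_⟩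
  exact (truncLog_mono f hc z).trans ((hM ⟨z, hz, rfl⟩).trans (le_max_left _ _))

lemma circleIntegrable_of_bounded {u : ℂ → ℝ} (hu : Measurable u) {c : ℂ} {r A : ℝ}
    (hA : ∀ z ∈ Metric.sphere c |r|, |u z| ≤ A) : CircleIntegrable u c r := by
  refine (intervalIntegrable_const (c := A)).mono_fun
    (hu.comp (continuous_circleMap c r).measurable).aestronglyMeasurable ?_
  refine Eventually.of_forall fun θ ↦ ?_
  have := hA _ (circleMap_mem_sphere' c r θ)
  exact this.trans (le_abs_self A)

lemma truncLog_circleIntegrable {f : ℂ → ℝ} (hf : UpperSemicontinuous f) (c : ℝ) (z : ℂ) (r : ℝ) :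
    CircleIntegrable (truncLog f c) z r := by
  obtain ⟨M, hM⟩ := UpperSemicontinuousOn.bddAbove_of_isCompact (isCompact_sphere z |r|)
    ((truncLog_upperSemicontinuous hf c).upperSemicontinuousOn _)
  refine circleIntegrable_of_bounded (truncLog_measurable hf c) (A := max |M| |c|) fun w hw ↦ ?_
  rw [abs_le']
  refine ⟨(hM ⟨w, hw, rfl⟩).trans ((le_abs_self M).trans (le_max_left _ _)), ?_⟩
  have := le_truncLog f c w
  have := neg_abs_le c
  have := le_max_right |M| |c|
  linarith

section
variable {h : (Fin 2 → ℂ) → ℝ}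

lemma ae_ne_zero_of_logPSH (hpos : ∀ z, 0 ≤ h z) (husc : UpperSemicontinuous h)
    (hhom : AbsHomog h) (hpsh : LogPSH h) {a b : Fin 2 → ℂ} {r : ℝ} (hr : 0 < r) (ha : h a ≠ 0) :
    ∀ᵐ θ : ℝ ∂(volume.restrict (Set.Ioc 0 (2 * Real.pi))),
      h (a + ((r : ℂ) * Complex.exp (θ * Complex.I)) • b) ≠ 0 := by
  set g : ℝ → Fin 2 → ℂ := fun θ ↦ a + ((r : ℂ) * Complex.exp (θ * Complex.I)) • b with hg
  have hgc : Continuous g := by fun_prop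
  have hm : Measurable fun θ ↦ h (g θ) := husc.measurable.comp hgc.measurable
  set E : Set ℝ := {θ | h (g θ) = 0} with hE
  have hEm : MeasurableSet E := hm (measurableSet_singleton 0)
  set μ := volume.restrict (Set.Ioc 0 (2 * Real.pi)) with hμ
  have hfin : IsFiniteMeasure μ := by rw [hμ]; infer_instance
  have hμE : μ.real Set.univ = 2 * Real.pi := by
    simp [hμ, Measure.real, Real.pi_pos.le]
  obtain ⟨M, hM⟩ := UpperSemicontinuousOn.bddAbove_of_isCompact
    ((isCompact_Icc (a := (0:ℝ)) (b := 2 * Real.pi)).image hgc) (husc.upperSemicontinuousOn _)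
  set B : ℝ := Real.log (max M 1) with hB
  have hB0 : 0 ≤ B := Real.log_nonneg (le_max_right _ _)
  have key : ∀ t : ℝ, 0 ≤ t → t + Real.log (h a) ≤
      (1 / (2 * Real.pi)) * ((t + B) * μ.real Eᶜ) := by
    intro t ht
    have hs : ∀ z, h ((Real.exp t : ℂ) • z) = Real.exp t * h z := fun z ↦ by
      rw [hhom, Complex.norm_real, Real.norm_of_nonneg (Real.exp_pos t).le]
    have h1 := hpsh ((Real.exp t : ℂ) • a) ((Real.exp t : ℂ) • b) r hr
      (by rw [hs]; exact mul_ne_zero (Real.exp_pos t).ne' ha) 0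
    rw [hs, Real.log_mul (Real.exp_pos t).ne' ha, Real.log_exp] at h1
    refine h1.trans (mul_le_mul_of_nonneg_left ?_ (by positivity))
    rw [intervalIntegral.integral_of_le (by positivity)]
    have e : (t + B) * μ.real Eᶜ = ∫ θ, Eᶜ.indicator (fun _ ↦ t + B) θ ∂μ := by
      rw [integral_indicator_const _ hEm.compl, smul_eq_mul, mul_comm]
    rw [e]
    refine integral_mono_of_nonneg (Eventually.of_forall fun θ ↦ le_max_right _ _)
      ((integrable_const _).indicator hEm.compl) ?_
    filter_upwards [ae_restrict_mem measurableSet_Ioc] with θ hθ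
    have e2 : (Real.exp t : ℂ) • a + ((r : ℂ) * Complex.exp (θ * Complex.I)) •
        ((Real.exp t : ℂ) • b) = (Real.exp t : ℂ) • g θ := by
      rw [hg, smul_add, smul_comm]
    rw [e2, hs]
    by_cases hz : h (g θ) = 0
    · have : θ ∉ Eᶜ := fun h ↦ h hz
      simp [hz, this]
    · have : θ ∈ Eᶜ := hz
      rw [Set.indicator_of_mem this, Real.log_mul (Real.exp_pos t).ne' hz, Real.log_exp]
      refine max_le ?_ (by positivity)
      have : h (g θ) ≤ M := hM ⟨g θ, ⟨θ, ⟨hθ.1.le, hθ.2⟩, rfl⟩, rfl⟩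
      have := Real.log_le_log (lt_of_le_of_ne (hpos _) (Ne.symm hz)) (this.trans (le_max_left M 1))
      linarith
  have hc : μ.real Eᶜ = 2 * Real.pi - μ.real E := by
    rw [measureReal_compl hEm, hμE]
  have hE0 : μ.real E = 0 := by
    by_contra hne
    have hp : 0 < μ.real E := lt_of_le_of_ne measureReal_nonneg (Ne.symm hne)
    set t := (|B - Real.log (h a)| + 1) * (2 * Real.pi) / μ.real E with ht
    have h1 := key t (by positivity)
    rw [hc] at h1
    have hpi := Real.pi_pos
    have h2 : (1 / (2 * Real.pi)) * ((t + B) * (2 * Real.pi - μ.real E)) =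
        t + B - (t * μ.real E) / (2 * Real.pi) - B * μ.real E / (2 * Real.pi) := by
      field_simp
      ring
    have h3 : t * μ.real E / (2 * Real.pi) = |B - Real.log (h a)| + 1 := by
      rw [ht]; field_simp
    have h4 : 0 ≤ B * μ.real E / (2 * Real.pi) := by positivity
    rw [h2, h3] at h1
    have := le_abs_self (B - Real.log (h a))
    linarith
  have : μ E = 0 := by
    rwa [measureReal_eq_zero_iff] at hE0
  exact measure_eq_zero_iff_ae_notMem.1 this

lemma logSubharmonic_line (hpos : ∀ z, 0 ≤ h z) (husc : UpperSemicontinuous h)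
    (hhom : AbsHomog h) (hpsh : LogPSH h) (hne : ∃ z, h z ≠ 0) {a b : Fin 2 → ℂ}
    (hab : ∀ z : Fin 2 → ℂ, ∃ s t : ℂ, z = s • b + t • a) :
    LogSubharmonic fun ζ : ℂ ↦ h (a + ζ • b) := by
  have hf : UpperSemicontinuous fun ζ : ℂ ↦ h (a + ζ • b) :=
    husc.comp (by fun_prop)
  refine ⟨fun _ ↦ hpos _, hf, fun c z r hr ↦ ?_, ?_⟩
  · have hi := truncLog_circleIntegrable hf c z r
    have hcle : c ≤ Real.circleAverage (truncLog (fun ζ : ℂ ↦ h (a + ζ • b)) c) z r := by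
      have := Real.circleAverage_mono (c := z) (R := r) (f₁ := fun _ ↦ c)
        (circleIntegrable_const _ _ _) hi (fun x _ ↦ le_truncLog _ c x)
      rwa [Real.circleAverage_const] at this
    by_cases h0 : h (a + z • b) = 0
    · rw [truncLog_le_iff]
      refine ⟨?_, hcle⟩
      simp only [h0]
      positivity
    · rw [truncLog_of_pos c (lt_of_le_of_ne (hpos _) (Ne.symm h0))]
      refine max_le ?_ hcle
      refine (hpsh (a + z • b) b r hr h0 c).trans (le_of_eq ?_)
      rw [Real.circleAverage, smul_eq_mul, one_div]
      congr 1
      rw [intervalIntegral.integral_of_le (by positivity),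
        intervalIntegral.integral_of_le (by positivity)]
      refine integral_congr_ae ?_
      filter_upwards [ae_ne_zero_of_logPSH hpos husc hhom hpsh hr h0 (b := b)] with θ hθ
      have e : a + z • b + ((r : ℂ) * Complex.exp (θ * Complex.I)) • b
          = a + (circleMap z r θ) • b := by
        rw [circleMap, add_smul, add_assoc]
      rw [e] at hθ ⊢
      exact (truncLog_of_pos (f := fun ζ : ℂ ↦ h (a + ζ • b)) c
        (lt_of_le_of_ne (hpos _) (Ne.symm hθ))).symm
  · by_contra! hall
    obtain ⟨z, hz⟩ := hne
    have hs : ∀ s t : ℂ, t ≠ 0 → h (s • b + t • a) = 0 := fun s t ht ↦ by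
      have : s • b + t • a = t • (a + (s / t) • b) := by
        rw [smul_add, smul_smul, mul_div_cancel₀ _ ht, add_comm]
      rw [this, hhom, hall, mul_zero]
    obtain ⟨s, t, rfl⟩ := hab z
    have h1 := ae_ne_zero_of_logPSH hpos husc hhom hpsh (r := ‖t‖ + 1) (b := a) (by positivity) hz
    have h2 : ∀ᵐ θ : ℝ ∂(volume.restrict (Set.Ioc 0 (2 * Real.pi))), False := by
      filter_upwards [h1] with θ hθ
      apply hθ
      rw [add_assoc, ← add_smul]
      apply hs
      intro h0
      have := congrArg norm (eq_neg_of_add_eq_zero_left h0)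
      rw [norm_neg, norm_mul, Complex.norm_exp_ofReal_mul_I, mul_one, Complex.norm_real,
        Real.norm_of_nonneg (by positivity)] at this
      linarith
    rw [eventually_false_iff_eq_bot, ae_eq_bot, Measure.restrict_eq_zero] at h2
    simp [Real.pi_pos.not_ge] at h2

end

lemma circleAverage_log_norm_of_lt {z : ℂ} {r : ℝ} (hr : 0 < r) (hz : r ≤ ‖z‖) :
    Real.circleAverage (fun w ↦ Real.log ‖w‖) z r = Real.log ‖z‖ := by
  have h := circleAverage_log_norm_sub_const_eq_log_radius_add_posLog (a := 0) (c := z) hr.ne'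
  simp only [sub_zero] at h
  have h1 : 1 ≤ r⁻¹ * ‖z‖ := by
    rw [← div_eq_inv_mul]; exact (one_le_div hr).2 hz
  rw [h, Real.posLog_eq_log (by rwa [abs_of_pos (by linarith)]),
    Real.log_mul (by positivity) (by linarith), Real.log_inv]
  ring

lemma circleIntegrable_log_norm (z : ℂ) (r : ℝ) :
    CircleIntegrable (fun w ↦ Real.log ‖w‖) z r := by
  simpa using circleIntegrable_log_norm_sub_const (a := 0) (c := z) r

lemma circleAverage_norm_sq (z : ℂ) (r : ℝ) :
    Real.circleAverage (fun w ↦ ‖w‖ ^ 2) z r = ‖z‖ ^ 2 + r ^ 2 := by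
  have hd : Real.circleAverage (fun w : ℂ ↦ (starRingEnd ℂ) z * w) z r = (starRingEnd ℂ) z * z :=
    DiffContOnCl.circleAverage (Differentiable.diffContOnCl (by fun_prop))
  have hre : Real.circleAverage (fun w : ℂ ↦ ((starRingEnd ℂ) z * w).re) z r
      = ((starRingEnd ℂ) z * z).re := by
    rw [← hd]
    exact Complex.reCLM.circleAverage_comp_comm (f := fun w : ℂ ↦ (starRingEnd ℂ) z * w)
      (Continuous.continuousOn (by fun_prop)).circleIntegrable'
  have hn : ∀ w : ℂ, ‖w‖ ^ 2 = w.re ^ 2 + w.im ^ 2 := fun w ↦ by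
    rw [Complex.sq_norm, Complex.normSq_apply]; ring
  have e : Set.EqOn (fun w : ℂ ↦ ‖w‖ ^ 2)
      (fun w ↦ (2 : ℝ) • ((starRingEnd ℂ) z * w).re + (r ^ 2 - ‖z‖ ^ 2)) (Metric.sphere z |r|) := by
    intro w hw
    have h1 : ‖w - z‖ ^ 2 = r ^ 2 := by
      rw [mem_sphere_iff_norm.1 hw, sq_abs]
    rw [hn] at h1
    simp only [hn, Complex.mul_re, Complex.conj_re, Complex.conj_im, Complex.sub_re,
      Complex.sub_im, smul_eq_mul] at h1 ⊢
    linarith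
  rw [Real.circleAverage_congr_sphere e, Real.circleAverage_fun_add, Real.circleAverage_fun_smul,
    hre, Real.circleAverage_const, hn]
  · simp only [Complex.mul_re, Complex.conj_re, Complex.conj_im, smul_eq_mul]
    ring
  · exact (Continuous.continuousOn (by fun_prop)).circleIntegrable'
  · exact circleIntegrable_const _ _ _

section

variable {f : ℂ → ℝ}

lemma LogSubharmonic.three_circles (hf : LogSubharmonic f) {r R α β : ℝ} (hr0 : 0 < r)
    (hr : ∀ z, ‖z‖ = r → f z ≤ Real.exp (α * Real.log ‖z‖ + β))
    (hR : ∀ z, ‖z‖ = R → f z ≤ Real.exp (α * Real.log ‖z‖ + β)) {z : ℂ}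
    (hrz : r ≤ ‖z‖) (hzR : ‖z‖ ≤ R) : f z ≤ Real.exp (α * Real.log ‖z‖ + β) := by
  set c : ℝ := -(|α| * max |Real.log r| |Real.log R| + |β|) with hc
  set A : Set ℂ := {w | r ≤ ‖w‖ ∧ ‖w‖ ≤ R} with hA
  have hAc : IsCompact A := by
    refine (isCompact_closedBall (0:ℂ) R).of_isClosed_subset ?_ ?_
    · exact (isClosed_le continuous_const continuous_norm).inter
        (isClosed_le continuous_norm continuous_const)
    · intro w hw; simpa using hw.2
  have hcA : ∀ w ∈ A, c ≤ α * Real.log ‖w‖ + β := by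
    intro w hw
    have h1 : |Real.log ‖w‖| ≤ max |Real.log r| |Real.log R| :=
      abs_le_max_abs_abs (Real.log_le_log hr0 hw.1) (Real.log_le_log (hr0.trans_le hw.1) hw.2)
    have h2 : |α * Real.log ‖w‖| ≤ |α| * max |Real.log r| |Real.log R| := by
      rw [abs_mul]; gcongr
    have h3 := neg_abs_le (α * Real.log ‖w‖)
    have h4 := neg_abs_le β
    linarith
  set u := truncLog f c with hu
  have key : ∀ ε > 0, u z ≤ α * Real.log ‖z‖ + β + ε * R ^ 2 := by
    intro ε hε
    set g : ℂ → ℝ := fun w ↦ -(α * Real.log ‖w‖ + β) + ε * ‖w‖ ^ 2 with hg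
    have hgc : ContinuousOn g A := by
      refine ((((continuous_norm.continuousOn).log fun w hw ↦ ?_).const_mul α).add
        continuousOn_const).neg.add (by fun_prop)
      exact (hr0.trans_le hw.1).ne'
    have husc : UpperSemicontinuousOn (fun w ↦ u w + g w) A :=
      ((truncLog_upperSemicontinuous hf.usc c).upperSemicontinuousOn A).add
        hgc.upperSemicontinuousOn
    obtain ⟨z₀, hz₀, hmax⟩ := UpperSemicontinuousOn.exists_isMaxOn (s := A) ⟨z, hrz, hzR⟩ hAc husc
    have hz0R : ε * ‖z₀‖ ^ 2 ≤ ε * R ^ 2 := by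
      have := hz₀.2
      gcongr
    have hedge : f z₀ ≤ Real.exp (α * Real.log ‖z₀‖ + β) →
        u z ≤ α * Real.log ‖z‖ + β + ε * R ^ 2 := by
      intro h
      have h1 : u z₀ ≤ α * Real.log ‖z₀‖ + β := truncLog_le_iff.2 ⟨h, hcA _ hz₀⟩
      have h2 : u z + g z ≤ u z₀ + g z₀ := hmax (show z ∈ A from ⟨hrz, hzR⟩)
      have h3 : 0 ≤ ε * ‖z‖ ^ 2 := by positivity
      simp only [hg] at h2
      linarith
    rcases eq_or_lt_of_le hz₀.1 with h1 | h1
    · exact hedge (hr _ h1.symm)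
    rcases eq_or_lt_of_le hz₀.2 with h2 | h2
    · exact hedge (hR _ h2)
    exfalso
    obtain ⟨ρ, hρ, hρ1, hρ2⟩ : ∃ ρ > 0, ρ ≤ ‖z₀‖ - r ∧ ρ ≤ R - ‖z₀‖ :=
      ⟨min (‖z₀‖ - r) (R - ‖z₀‖), lt_min (by linarith) (by linarith), min_le_left _ _,
        min_le_right _ _⟩
    have hsub := hf.submean c z₀ ρ hρ
    have hii := circleIntegrable_log_norm z₀ ρ
    have hlin : CircleIntegrable (fun w ↦ α • Real.log ‖w‖ + (u z₀ + g z₀ + β)) z₀ ρ :=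
      (hii.const_smul).add (circleIntegrable_const _ _ _)
    have hsq : CircleIntegrable (fun w : ℂ ↦ ε • ‖w‖ ^ 2) z₀ ρ :=
      (Continuous.continuousOn (by fun_prop)).circleIntegrable'
    have hle : Real.circleAverage u z₀ ρ ≤ Real.circleAverage
        (fun w ↦ (α • Real.log ‖w‖ + (u z₀ + g z₀ + β)) - ε • ‖w‖ ^ 2) z₀ ρ := by
      refine Real.circleAverage_mono (truncLog_circleIntegrable hf.usc c z₀ ρ) (hlin.sub hsq) ?_
      intro w hw
      have hw' : ‖w - z₀‖ = ρ := by rw [mem_sphere_iff_norm.1 hw, abs_of_pos hρ]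
      have h3 : ‖w‖ ≤ ‖z₀‖ + ρ := by
        have := norm_add_le (w - z₀) z₀; rw [sub_add_cancel] at this; linarith
      have h4 : ‖z₀‖ ≤ ‖w‖ + ρ := by
        have := norm_add_le (z₀ - w) w; rw [sub_add_cancel, norm_sub_rev] at this; linarith
      have h5 : u w + g w ≤ u z₀ + g z₀ := hmax (show w ∈ A from ⟨by linarith, by linarith⟩)
      simp only [hg, smul_eq_mul] at h5 ⊢
      linarith
    rw [Real.circleAverage_fun_sub hlin hsq,
      Real.circleAverage_fun_add (f₁ := fun w ↦ α • Real.log ‖w‖) hii.const_smul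
        (circleIntegrable_const _ _ _),
      Real.circleAverage_fun_smul, Real.circleAverage_fun_smul, Real.circleAverage_const,
      circleAverage_norm_sq, circleAverage_log_norm_of_lt hρ (by linarith)] at hle
    have h6 := hsub.trans hle
    have h7 : 0 < ε * ρ ^ 2 := by positivity
    simp only [hg, smul_eq_mul] at h6
    linarith
  have : u z ≤ α * Real.log ‖z‖ + β := by
    refine le_of_forall_pos_le_add fun δ hδ ↦ ?_
    refine (key (δ / (R ^ 2 + 1)) (by positivity)).trans ?_
    have : δ / (R ^ 2 + 1) * R ^ 2 ≤ δ := by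
      rw [div_mul_eq_mul_div, div_le_iff₀ (by positivity)]; nlinarith
    linarith
  exact (truncLog_le_iff.1 this).1

lemma LogSubharmonic.exists_le_exp (hf : LogSubharmonic f) (R : ℝ) :
    ∃ B, 0 ≤ B ∧ ∀ z, ‖z‖ ≤ R → f z ≤ Real.exp B := by
  obtain ⟨B, hB, h⟩ := exists_truncLog_le hf.usc (isCompact_closedBall (0:ℂ) R)
  exact ⟨B, hB, fun z hz ↦ (truncLog_le_iff.1 (h 0 le_rfl z (by simpa using hz))).1⟩

/-- If the logarithm of `f` is at most `s log r` on arbitrarily small circles, for all `s < s₀`,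
then `f` is dominated by a multiple of `‖z‖ ^ s₀` near the origin. -/
lemma LogSubharmonic.le_of_frequently (hf : LogSubharmonic f) {s₀ : ℝ} (hs₀ : 0 < s₀)
    (h : ∀ s, 0 < s → s < s₀ → ∃ᶠ r in 𝓝[>] (0:ℝ), ∀ z, ‖z‖ = r →
      f z ≤ Real.exp (s * Real.log r)) :
    ∃ B, ∀ z, z ≠ 0 → ‖z‖ < 1 → f z ≤ Real.exp (s₀ * Real.log ‖z‖ + B) := by
  obtain ⟨B, hB, hfB⟩ := hf.exists_le_exp 1
  refine ⟨B, fun z hz hz1 ↦ ?_⟩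
  have hpos : 0 < ‖z‖ := norm_pos_iff.2 hz
  have key : ∀ s, 0 < s → s < s₀ → f z ≤ Real.exp (s * Real.log ‖z‖ + B) := by
    intro s hs hs'
    obtain ⟨r, hr, hrz⟩ := ((h s hs hs').and_eventually
      (Ioo_mem_nhdsGT hpos)).exists
    refine hf.three_circles (R := 1) hrz.1 (fun w hw ↦ ?_) (fun w hw ↦ ?_) hrz.2.le hz1.le
    · refine (hr w hw).trans (Real.exp_le_exp.2 ?_)
      rw [hw]; linarith
    · rw [hw, Real.log_one]
      simpa using hfB w hw.le
  have hlim : Tendsto (fun s : ℝ ↦ Real.exp (s * Real.log ‖z‖ + B)) (𝓝[<] s₀)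
      (𝓝 (Real.exp (s₀ * Real.log ‖z‖ + B))) := by
    refine (Continuous.tendsto ?_ s₀).mono_left nhdsWithin_le_nhds
    fun_prop
  refine ge_of_tendsto hlim ?_
  filter_upwards [Ioo_mem_nhdsLT hs₀] with s hs using key s hs.1 hs.2

lemma LogSubharmonic.exists_pos_ne_zero (hf : LogSubharmonic f) : ∃ z, z ≠ 0 ∧ 0 < f z := by
  obtain ⟨z, hz⟩ := hf.nontrivial
  have hz' : 0 < f z := lt_of_le_of_ne (hf.nonneg z) hz.symm
  by_cases h0 : z = 0
  · subst h0
    by_contra! hall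
    have h1 := hf.submean (Real.log (f 0) - 1) 0 1 one_pos
    have h2 : Real.circleAverage (truncLog f (Real.log (f 0) - 1)) 0 1
        = Real.circleAverage (fun _ ↦ Real.log (f 0) - 1) 0 1 := by
      refine Real.circleAverage_congr_sphere fun w hw ↦ ?_
      have hw0 : w ≠ 0 := by
        rintro rfl; simp at hw
      have : f w = 0 := le_antisymm (hall w hw0) (hf.nonneg w)
      simp [truncLog, this, (Real.exp_pos _).le]
    rw [h2, Real.circleAverage_const] at h1
    have := log_le_truncLog (Real.log (f 0) - 1) hz'
    linarith
  · exact ⟨z, h0, hz'⟩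

/-- The maximum of `log f` on small circles is bounded below by a multiple of `log r`. -/
lemma LogSubharmonic.exists_exp_lt (hf : LogSubharmonic f) :
    ∃ C, ∀ᶠ r in 𝓝[>] (0:ℝ), ∃ z, ‖z‖ = r ∧ Real.exp (C * Real.log r) < f z := by
  obtain ⟨z, hz, hfz⟩ := hf.exists_pos_ne_zero
  have hpos : 0 < ‖z‖ := norm_pos_iff.2 hz
  set R := 2 * ‖z‖ with hR
  obtain ⟨B, hB, hfB⟩ := hf.exists_le_exp R
  have hl2 : 0 < Real.log 2 := Real.log_pos (by norm_num)
  set C := 2 * (|B - Real.log (f z)| + 1) / Real.log 2 with hC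
  have hC0 : 0 < C := by positivity
  refine ⟨C, ?_⟩
  filter_upwards [Ioo_mem_nhdsGT (lt_min (lt_min hpos one_half_pos)
    (inv_pos.2 (by positivity : 0 < R)))]
    with r hr
  obtain ⟨hr0, hr1⟩ := hr
  have hrz : r < ‖z‖ := hr1.trans_le ((min_le_left _ _).trans (min_le_left _ _))
  have hrh : r < 1 := by
    have := hr1.trans_le ((min_le_left _ _).trans (min_le_right _ _)); linarith
  have hrR : r < R⁻¹ := hr1.trans_le (min_le_right _ _)
  have hlr : Real.log r < 0 := Real.log_neg hr0 hrh
  have hlR : Real.log r ≤ - Real.log R := by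
    rw [← Real.log_inv]; exact Real.log_le_log hr0 hrR.le
  have hlrR : Real.log r < Real.log R := Real.log_lt_log hr0 (by linarith)
  by_contra! hcon
  set α := (C * Real.log r - B) / (Real.log r - Real.log R) with hα
  have hden : Real.log r - Real.log R < 0 := by linarith
  have hα1 : α * (Real.log r - Real.log R) = C * Real.log r - B := by
    rw [hα, div_mul_cancel₀ _ hden.ne]
  have h1 := hf.three_circles (r := r) (R := R) (α := α) (β := B - α * Real.log R) hr0
    (fun w hw ↦ (hcon w hw).trans (Real.exp_le_exp.2 (by rw [hw]; linarith)))
    (fun w hw ↦ (hfB w hw.le).trans (Real.exp_le_exp.2 (by rw [hw]; linarith)))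
    hrz.le (by linarith)
  have h2 : Real.log (f z) ≤ B - α * Real.log 2 := by
    rw [Real.log_le_iff_le_exp hfz]
    refine h1.trans (Real.exp_le_exp.2 (le_of_eq ?_))
    rw [hR, Real.log_mul (by norm_num) hpos.ne']
    ring
  have hα2 : C / 2 ≤ α := by
    rw [hα, le_div_iff_of_neg hden]
    nlinarith
  have h3 : C / 2 * Real.log 2 = |B - Real.log (f z)| + 1 := by
    rw [hC]; field_simp
  have h4 := mul_le_mul_of_nonneg_right hα2 hl2.le
  have := le_abs_self (B - Real.log (f z))
  linarith

end

/-- The difference between the logarithmic potential of `μ` and that of the point mass at the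
origin, for a rotation invariant probability measure `μ`. -/
def radialKernel (μ : Measure ℂ) (p : ℂ) : ℝ≥0∞ :=
  ∫⁻ w, ENNReal.ofReal (Real.posLog (‖w‖ / ‖p‖)) ∂μ

/-- Probability measures without atoms, supported in the disc of radius `ρ`, whose logarithmic
potential is that of a rotation invariant measure. -/
structure IsLogRadial (μ : Measure ℂ) (ρ : ℝ) : Prop where
  prob : IsProbabilityMeasure μ
  noAtoms : NullSingletonClass μ
  norm_le : ∀ᵐ w ∂μ, ‖w‖ ≤ ρ
  potential : ∀ p, p ≠ 0 → ∀ L, Real.log (1 + ‖p‖ + ρ) ≤ L →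
    radialKernel μ p + ∫⁻ w, ENNReal.ofReal (L - Real.log ‖p + w‖) ∂μ =
      ENNReal.ofReal (L - Real.log ‖p‖)

/-- The uniform probability measure on the circle of radius `r` about the origin. -/
def circleProb (r : ℝ) : Measure ℂ :=
  ((ENNReal.ofReal (2 * Real.pi))⁻¹ • volume.restrict (Set.Ioc 0 (2 * Real.pi))).map
    (circleMap 0 r)

lemma measurable_posLog_norm_div : Measurable fun x : ℂ × ℂ ↦ Real.posLog (‖x.2‖ / ‖x.1‖) := by
  unfold Real.posLog
  fun_prop

lemma measurable_radialKernel (μ : Measure ℂ) [SFinite μ] : Measurable (radialKernel μ) :=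
  Measurable.lintegral_prod_right' (f := fun x : ℂ × ℂ ↦
    ENNReal.ofReal (Real.posLog (‖x.2‖ / ‖x.1‖))) measurable_posLog_norm_div.ennreal_ofReal

lemma radialKernel_neg (μ : Measure ℂ) (p : ℂ) : radialKernel μ (-p) = radialKernel μ p := by
  simp [radialKernel]

instance (r : ℝ) : IsProbabilityMeasure (circleProb r) := by
  constructor
  have h0 : ENNReal.ofReal (2 * Real.pi) ≠ 0 := by
    simp [Real.pi_pos]
  rw [circleProb, Measure.map_apply (continuous_circleMap 0 r).measurable MeasurableSet.univ]
  simp only [Set.preimage_univ, Measure.smul_apply, Measure.restrict_apply_univ, Real.volume_Ioc,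
    sub_zero, smul_eq_mul]
  exact ENNReal.inv_mul_cancel h0 ENNReal.ofReal_ne_top

lemma ae_circleProb (r : ℝ) : ∀ᵐ w ∂(circleProb r), ‖w‖ = |r| := by
  rw [circleProb, ae_map_iff (continuous_circleMap 0 r).aemeasurable]
  · exact Eventually.of_forall fun θ ↦ norm_circleMap_zero r θ
  · exact measurableSet_eq_fun measurable_norm measurable_const

lemma lintegral_circleProb {g : ℂ → ℝ} (hg : Measurable g) (z : ℂ) (r : ℝ)
    (hi : CircleIntegrable g z r) (h0 : ∀ w ∈ Metric.sphere z |r|, 0 ≤ g w) :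
    ∫⁻ w, ENNReal.ofReal (g (z + w)) ∂(circleProb r) =
      ENNReal.ofReal (Real.circleAverage g z r) := by
  have hpi : (0:ℝ) ≤ 2 * Real.pi := by positivity
  have e : ∀ θ, z + circleMap 0 r θ = circleMap z r θ := fun θ ↦ by simp [circleMap]
  rw [circleProb, lintegral_map (by fun_prop) (continuous_circleMap 0 r).measurable,
    lintegral_smul_measure, Real.circleAverage, intervalIntegral.integral_of_le hpi]
  simp only [e, smul_eq_mul]
  rw [ENNReal.ofReal_mul (p := (2 * Real.pi)⁻¹) (by positivity),
    ENNReal.ofReal_inv_of_pos (by positivity),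
    ofReal_integral_eq_lintegral_ofReal]
  · exact (intervalIntegrable_iff_integrableOn_Ioc_of_le hpi).1 hi
  · exact Eventually.of_forall fun θ ↦ h0 _ (circleMap_mem_sphere' z r θ)

lemma log_norm_add_le {p w : ℂ} {ρ : ℝ} (hw : ‖w‖ ≤ ρ) :
    Real.log ‖p + w‖ ≤ Real.log (1 + ‖p‖ + ρ) := by
  have hρ : 0 ≤ ρ := (norm_nonneg w).trans hw
  have hp := norm_nonneg p
  rcases eq_or_lt_of_le (norm_nonneg (p + w)) with h | h
  · rw [← h, Real.log_zero]
    exact Real.log_nonneg (by linarith)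
  · exact Real.log_le_log h (by linarith [norm_add_le p w])

lemma circleAverage_log_norm_eq_max {p : ℂ} (hp : p ≠ 0) {r : ℝ} (hr : 0 ≤ r) :
    Real.circleAverage (fun w ↦ Real.log ‖w‖) p r =
      Real.log ‖p‖ + Real.posLog (r / ‖p‖) := by
  have hp0 : 0 < ‖p‖ := norm_pos_iff.2 hp
  rcases eq_or_lt_of_le hr with rfl | hr
  · simp
  have h := circleAverage_log_norm_sub_const_eq_log_radius_add_posLog (a := 0) (c := p) hr.ne'
  simp only [sub_zero] at h
  rw [h, Real.posLog, Real.posLog, Real.log_div hr.ne' hp0.ne',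
    Real.log_mul (inv_pos.2 hr).ne' hp0.ne', Real.log_inv]
  rcases le_total (Real.log r) (Real.log ‖p‖) with h | h
  · rw [max_eq_right (by linarith), max_eq_left (by linarith)]; ring
  · rw [max_eq_left (by linarith), max_eq_right (by linarith)]; ring

lemma lintegral_circleProb_log {p : ℂ} (hp : p ≠ 0) {r L : ℝ} (hr : 0 ≤ r)
    (hL : Real.log (1 + ‖p‖ + r) ≤ L) :
    ENNReal.ofReal (Real.posLog (r / ‖p‖)) +
      ∫⁻ w, ENNReal.ofReal (L - Real.log ‖p + w‖) ∂(circleProb r) =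
      ENNReal.ofReal (L - Real.log ‖p‖) := by
  have hnn : ∀ w ∈ Metric.sphere p |r|, 0 ≤ L - Real.log ‖w‖ := by
    intro w hw
    have h1 : ‖w - p‖ ≤ r := by rw [mem_sphere_iff_norm.1 hw, abs_of_nonneg hr]
    have := log_norm_add_le (p := p) h1
    rw [add_sub_cancel] at this
    linarith
  have hi : CircleIntegrable (fun w ↦ L - Real.log ‖w‖) p r :=
    (circleIntegrable_const L p r).sub (circleIntegrable_log_norm p r)
  have hm : Measurable fun w : ℂ ↦ L - Real.log ‖w‖ := by fun_prop
  rw [lintegral_circleProb (g := fun w ↦ L - Real.log ‖w‖) hm p r hi hnn,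
    ← ENNReal.ofReal_add Real.posLog_nonneg
      (Real.circleAverage_nonneg_of_nonneg hnn),
    Real.circleAverage_fun_sub (circleIntegrable_const L p r) (circleIntegrable_log_norm p r),
    Real.circleAverage_const, circleAverage_log_norm_eq_max hp hr]
  congr 1
  ring

lemma radialKernel_circleProb {r : ℝ} (hr : 0 ≤ r) (p : ℂ) :
    radialKernel (circleProb r) p = ENNReal.ofReal (Real.posLog (r / ‖p‖)) := by
  rw [radialKernel, lintegral_congr_ae (g := fun _ ↦ ENNReal.ofReal (Real.posLog (r / ‖p‖))),
    lintegral_const, measure_univ, mul_one]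
  filter_upwards [ae_circleProb r] with w hw
  rw [hw, abs_of_nonneg hr]

lemma isLogRadial_circleProb {r : ℝ} (hr : 0 < r) : IsLogRadial (circleProb r) r := by
  refine ⟨inferInstance, ⟨fun x ↦ ?_⟩, ?_, fun p hp L hL ↦ ?_⟩
  · rw [circleProb, Measure.map_apply (continuous_circleMap 0 r).measurable
      (measurableSet_singleton x)]
    refine Measure.smul_absolutelyContinuous ?_
    have hc : (circleMap 0 r ⁻¹' {x}).Countable :=
      (Set.countable_singleton x).preimage_circleMap 0 hr.ne'
    exact hc.measure_zero _
  · filter_upwards [ae_circleProb r] with w hw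
    rw [hw, abs_of_pos hr]
  · rw [radialKernel_circleProb hr.le]
    exact lintegral_circleProb_log hp hr.le hL

/-- The uniform probability measure on the disc of radius `r` about the origin. -/
def discProb (r : ℝ) : Measure ℂ :=
  (volume (Metric.ball (0:ℂ) r))⁻¹ • volume.restrict (Metric.ball (0:ℂ) r)

lemma isProbabilityMeasure_discProb {r : ℝ} (hr : 0 < r) :
    IsProbabilityMeasure (discProb r) := by
  constructor
  rw [discProb, Measure.smul_apply, Measure.restrict_apply_univ, smul_eq_mul]
  exact ENNReal.inv_mul_cancel (Metric.measure_ball_pos _ _ hr).ne' measure_ball_lt_top.ne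

instance (r : ℝ) : SFinite (discProb r) := by
  rw [discProb]; infer_instance

lemma ae_discProb (r : ℝ) : ∀ᵐ w ∂(discProb r), ‖w‖ < r := by
  refine Measure.ae_smul_measure ?_ _
  filter_upwards [ae_restrict_mem measurableSet_ball] with w hw
  simpa using hw

lemma lintegral_ball_rotate (g : ℂ → ℝ≥0∞) (r : ℝ) {ζ : ℂ} (hζ : ‖ζ‖ = 1) :
    ∫⁻ w in Metric.ball 0 r, g (ζ * w) = ∫⁻ w in Metric.ball 0 r, g w := by
  let R : ℂ ≃ₗᵢ[ℝ] ℂ := rotation (⟨ζ, mem_sphere_zero_iff_norm.2 hζ⟩ : Circle)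
  have hR : MeasurePreserving R volume volume := R.measurePreserving
  have := hR.setLIntegral_comp_preimage_emb R.toHomeomorph.measurableEmbedding g
    (Metric.ball 0 r)
  rw [← this]
  have e : R ⁻¹' Metric.ball 0 r = Metric.ball 0 r := by
    ext w; simp
  rw [e]
  rfl

lemma lintegral_discProb {g : ℂ → ℝ≥0∞} (hg : Measurable g) (r : ℝ) (p : ℂ) :
    ∫⁻ w, g (p + w) ∂(discProb r) =
      ∫⁻ w, ∫⁻ q, g (p + q) ∂(circleProb ‖w‖) ∂(discProb r) := by
  rw [discProb, lintegral_smul_measure, lintegral_smul_measure]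
  congr 1
  have h1 : ∀ w : ℂ, ∫⁻ q, g (p + q) ∂(circleProb ‖w‖) = ∫⁻ ζ, g (p + ζ * ‖w‖) ∂(circleProb 1) := by
    intro w
    have e : circleProb ‖w‖ = (circleProb 1).map (fun ζ ↦ ζ * (‖w‖ : ℂ)) := by
      rw [circleProb, circleProb, Measure.map_map (by fun_prop)
        (continuous_circleMap 0 1).measurable]
      congr 1
      ext θ
      simp [circleMap, mul_comm]
    rw [e, lintegral_map (by fun_prop) (by fun_prop)]
  have h2 : ∀ w : ℂ, ∫⁻ ζ, g (p + ζ * ‖w‖) ∂(circleProb 1) =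
      ∫⁻ ζ, g (p + ζ * w) ∂(circleProb 1) := by
    intro w
    obtain ⟨φ, hφ⟩ : ∃ φ : ℝ, w = ‖w‖ * Complex.exp (φ * Complex.I) :=
      ⟨w.arg, (Complex.norm_mul_exp_arg_mul_I w).symm⟩
    have hm : ∀ a : ℂ, Measurable fun ζ : ℂ ↦ g (p + ζ * a) := fun a ↦ by fun_prop
    rw [circleProb, lintegral_map (hm _) (continuous_circleMap 0 1).measurable,
      lintegral_map (hm _) (continuous_circleMap 0 1).measurable, lintegral_smul_measure,
      lintegral_smul_measure]
    congr 1
    set G : ℝ → ℝ≥0∞ := fun θ ↦ g (p + circleMap 0 1 θ * ‖w‖) with hG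
    have hper : Function.Periodic G (2 * Real.pi) := fun θ ↦ by
      simp only [hG, periodic_circleMap 0 1 θ]
    have e : ∀ θ, g (p + circleMap 0 1 θ * w) = G (θ + φ) := by
      intro θ
      simp only [hG, circleMap, Complex.ofReal_add, add_mul, Complex.exp_add]
      congr 2
      conv_lhs => rw [hφ]
      ring
    have hGm : Measurable G := by
      have := hm ‖w‖
      exact this.comp (continuous_circleMap 0 1).measurable
    simp only [e]
    have e2 : ∫⁻ θ in Set.Ioc 0 (2 * Real.pi), G (θ + φ) =
        ∫⁻ θ in Set.Ioc φ (φ + 2 * Real.pi), G θ := by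
      have := (measurePreserving_add_right (volume : Measure ℝ) φ).setLIntegral_comp_preimage_emb
        (measurableEmbedding_addRight φ) G (Set.Ioc φ (φ + 2 * Real.pi))
      rw [← this]
      congr 2
      ext x
      simp only [Set.mem_preimage, Set.mem_Ioc]
      constructor <;> rintro ⟨h1, h2⟩ <;> constructor <;> linarith
    rw [e2]
    have F1 := isAddFundamentalDomain_Ioc (T := 2 * Real.pi) (by positivity) 0
    have F2 := isAddFundamentalDomain_Ioc (T := 2 * Real.pi) (by positivity) φ
    rw [zero_add] at F1
    refine F1.setLIntegral_eq F2 G fun x y ↦ ?_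
    obtain ⟨x, hx⟩ := x
    obtain ⟨n, rfl⟩ := AddSubgroup.mem_zmultiples_iff.1 hx
    have := hper.zsmul n y
    rw [← this, add_comm]
    rfl
  simp only [h1, h2]
  rw [lintegral_lintegral_swap]
  · have h3 : ∀ᵐ ζ ∂(circleProb 1), ∫⁻ w in Metric.ball 0 r, g (p + ζ * w) =
        ∫⁻ w in Metric.ball 0 r, g (p + w) := by
      filter_upwards [ae_circleProb 1] with ζ hζ
      exact lintegral_ball_rotate (fun w ↦ g (p + w)) r (ζ := ζ) (by simpa using hζ)
    rw [lintegral_congr_ae h3, lintegral_const, measure_univ, mul_one]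
  · fun_prop

lemma isLogRadial_discProb {r : ℝ} (hr : 0 < r) : IsLogRadial (discProb r) r := by
  have := isProbabilityMeasure_discProb hr
  refine ⟨this, ⟨fun x ↦ ?_⟩, ?_, fun p hp L hL ↦ ?_⟩
  · simp [discProb]
  · filter_upwards [ae_discProb r] with w hw using hw.le
  · rw [lintegral_discProb (g := fun w ↦ ENNReal.ofReal (L - Real.log ‖w‖)) (by fun_prop),
      radialKernel, ← lintegral_add_left (f := fun w ↦ ENNReal.ofReal (Real.posLog (‖w‖ / ‖p‖)))
        ((measurable_posLog_norm_div.comp measurable_prodMk_left).ennreal_ofReal)]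
    rw [lintegral_congr_ae (g := fun _ ↦ ENNReal.ofReal (L - Real.log ‖p‖)),
      lintegral_const, measure_univ, mul_one]
    filter_upwards [ae_discProb r] with w hw
    refine lintegral_circleProb_log hp (norm_nonneg w) (le_trans ?_ hL)
    have := norm_nonneg p
    have := norm_nonneg w
    exact Real.log_le_log (by positivity) (by linarith)

lemma posLog_mono_div {a b p : ℝ} (ha : 0 ≤ a) (h : a ≤ b) (hp : 0 ≤ p) :
    Real.posLog (a / p) ≤ Real.posLog (b / p) :=
  Real.posLog_le_posLog (by positivity) (by gcongr)

lemma IsLogRadial.radialKernel_le {μ : Measure ℂ} {ρ : ℝ} (h : IsLogRadial μ ρ) (p : ℂ) :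
    radialKernel μ p ≤ ENNReal.ofReal (Real.posLog (ρ / ‖p‖)) := by
  have := h.prob
  calc radialKernel μ p ≤ ∫⁻ _, ENNReal.ofReal (Real.posLog (ρ / ‖p‖)) ∂μ := by
        refine lintegral_mono_ae ?_
        filter_upwards [h.norm_le] with w hw
        exact ENNReal.ofReal_le_ofReal (posLog_mono_div (norm_nonneg w) hw (norm_nonneg p))
    _ = _ := by rw [lintegral_const, measure_univ, mul_one]

lemma IsLogRadial.radialKernel_add_comm {μ ν : Measure ℂ} {ρ δ : ℝ} (hμ : IsLogRadial μ ρ)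
    (hν : IsLogRadial ν δ) {p : ℂ} (hp : p ≠ 0) :
    radialKernel μ p + ∫⁻ w, radialKernel ν (p + w) ∂μ =
      radialKernel ν p + ∫⁻ w, radialKernel μ (p + w) ∂ν := by
  have := hμ.prob
  have := hν.prob
  have hp0 := norm_nonneg p
  have pos : ∀ {μ : Measure ℂ} {ρ : ℝ}, IsLogRadial μ ρ → 0 ≤ ρ := by
    intro μ ρ h
    have := h.prob
    obtain ⟨w, hw⟩ := h.norm_le.exists
    exact (norm_nonneg w).trans hw
  have hρ := pos hμ
  have hδ := pos hν
  set L := Real.log (1 + ‖p‖ + ρ + δ) with hL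
  set k : ℂ → ℝ≥0∞ := fun w ↦ ENNReal.ofReal (L - Real.log ‖w‖) with hk
  have hkm : Measurable k := by fun_prop
  have key : ∀ {μ ν : Measure ℂ} {ρ δ : ℝ}, IsLogRadial μ ρ → IsLogRadial ν δ →
      L = Real.log (1 + ‖p‖ + ρ + δ) →
      radialKernel μ p + ∫⁻ w, radialKernel ν (p + w) ∂μ + ∫⁻ w, ∫⁻ q, k (p + w + q) ∂ν ∂μ
        = k p := by
    intro μ ν ρ δ hμ hν hL
    have hρ := pos hμ
    have hδ := pos hν
    have := hμ.prob
    have := hν.prob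
    have := hμ.noAtoms
    have hJ : Measurable fun w ↦ radialKernel ν (p + w) :=
      (measurable_radialKernel ν).comp (measurable_const_add p)
    rw [add_assoc, ← lintegral_add_left hJ]
    have h1 : ∀ᵐ w ∂μ, radialKernel ν (p + w) + ∫⁻ q, k (p + w + q) ∂ν = k (p + w) := by
      have h2 : ∀ᵐ w ∂μ, w ≠ -p := by simp [ae_iff]
      filter_upwards [hμ.norm_le, h2] with w hw hwp
      refine hν.potential (p + w) (fun h ↦ hwp (eq_neg_of_add_eq_zero_right h)) L ?_
      rw [hL]
      have := norm_add_le p w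
      exact Real.log_le_log (by positivity) (by linarith)
    rw [lintegral_congr_ae h1]
    refine hμ.potential p hp L ?_
    rw [hL]
    exact Real.log_le_log (by positivity) (by linarith)
  have h1 := key hμ hν hL
  have h2 := key hν hμ (by rw [hL]; congr 1; ring)
  have hswap : ∫⁻ w, ∫⁻ q, k (p + w + q) ∂ν ∂μ = ∫⁻ w, ∫⁻ q, k (p + w + q) ∂μ ∂ν := by
    rw [lintegral_lintegral_swap (by fun_prop)]
    simp only [add_right_comm]
  rw [← hswap] at h2
  have hfin : ∫⁻ w, ∫⁻ q, k (p + w + q) ∂ν ∂μ ≠ ∞ := by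
    refine ne_top_of_le_ne_top (b := k p) ENNReal.ofReal_ne_top ?_
    rw [← h1]; exact le_add_self
  exact (ENNReal.add_left_inj hfin).1 (h1.trans h2.symm)

lemma lintegral_mul_lintegral_add {μ : Measure ℂ} [SFinite μ] {F G : ℂ → ℝ≥0∞}
    (hF : Measurable F) (hG : Measurable G) :
    ∫⁻ p, G p * ∫⁻ q, F (p + q) ∂μ = ∫⁻ p, (∫⁻ q, G (p - q) ∂μ) * F p := by
  calc ∫⁻ p, G p * ∫⁻ q, F (p + q) ∂μ = ∫⁻ p, ∫⁻ q, G p * F (p + q) ∂μ := by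
        refine lintegral_congr fun p ↦ ?_
        rw [lintegral_const_mul _ (by fun_prop)]
    _ = ∫⁻ q, (∫⁻ p, G p * F (p + q)) ∂μ := lintegral_lintegral_swap (by fun_prop)
    _ = ∫⁻ q, (∫⁻ p, G (p - q) * F p) ∂μ := by
        refine lintegral_congr fun q ↦ ?_
        rw [← lintegral_add_right_eq_self (fun p ↦ G (p - q) * F p) q]
        simp
    _ = ∫⁻ p, ∫⁻ q, G (p - q) * F p ∂μ := lintegral_lintegral_swap (by fun_prop)
    _ = _ := by
        refine lintegral_congr fun p ↦ ?_
        rw [lintegral_mul_const _ (by fun_prop)]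

lemma IsLogRadial.conv_comm {μ ν : Measure ℂ} {ρ δ : ℝ} (hμ : IsLogRadial μ ρ)
    (hν : IsLogRadial ν δ) {F : ℂ → ℝ≥0∞} (hF : Measurable F) (z : ℂ) :
    (∫⁻ p, radialKernel μ p * F (z + p)) +
        (∫⁻ p, radialKernel ν p * ∫⁻ q, F (z + p + q) ∂μ) =
      (∫⁻ p, radialKernel ν p * F (z + p)) +
        (∫⁻ p, radialKernel μ p * ∫⁻ q, F (z + p + q) ∂ν) := by
  have := hμ.prob
  have := hν.prob
  have hFz : Measurable fun p ↦ F (z + p) := by fun_prop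
  have e : ∀ {μ ν : Measure ℂ} [IsProbabilityMeasure μ] [IsProbabilityMeasure ν],
      (∫⁻ p, radialKernel μ p * F (z + p)) +
        (∫⁻ p, radialKernel ν p * ∫⁻ q, F (z + p + q) ∂μ) =
      ∫⁻ p, (radialKernel μ (-p) + ∫⁻ q, radialKernel ν (-p + q) ∂μ) * F (z + p) := by
    intro μ ν _ _
    have h1 := lintegral_mul_lintegral_add (μ := μ) hFz (measurable_radialKernel ν)
    simp only [← add_assoc] at h1
    have hm : Measurable fun p ↦ radialKernel μ p * F (z + p) :=
      (measurable_radialKernel μ).mul hFz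
    rw [h1, ← lintegral_add_left hm]
    refine lintegral_congr fun p ↦ ?_
    rw [add_mul, radialKernel_neg]
    congr 2
    refine lintegral_congr fun q ↦ ?_
    rw [← radialKernel_neg]
    congr 1; ring
  rw [e, e]
  refine lintegral_congr_ae ?_
  have h0 : ∀ᵐ p : ℂ, p ≠ 0 := by simp [ae_iff]
  filter_upwards [h0] with p hp
  rw [hμ.radialKernel_add_comm hν (neg_ne_zero.2 hp)]

section

variable {E : Type*} [NormedAddCommGroup E] [NormedSpace ℝ E] [FiniteDimensional ℝ E]
  [Nontrivial E] [MeasurableSpace E] [BorelSpace E] (μ : Measure E) [μ.IsAddHaarMeasure]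

lemma lintegral_ball_norm_rpow_lt_top_iff {R : ℝ} (hR : 0 < R) (s : ℝ) :
    ∫⁻ p in Metric.ball (0:E) R, ENNReal.ofReal (‖p‖ ^ s) ∂μ < ⊤ ↔
      -(Module.finrank ℝ E : ℝ) < s := by
  have hd : 1 ≤ Module.finrank ℝ E := Module.finrank_pos
  have key : IntegrableOn (fun p : E ↦ ‖p‖ ^ s) (Metric.ball 0 R) μ ↔
      -(Module.finrank ℝ E : ℝ) < s := by
    rw [integrableOn_fun_norm_addHaar (μ := μ) (f := fun y : ℝ ↦ y ^ s),
      integrableOn_congr_fun (g := fun y : ℝ ↦ y ^ (s + Module.finrank ℝ E - 1)) ?_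
      measurableSet_Ioo, intervalIntegral.integrableOn_Ioo_rpow_iff hR]
    · constructor <;> intro h <;> linarith
    · intro y hy
      simp only [smul_eq_mul]
      rw [← Real.rpow_natCast, ← Real.rpow_add hy.1, Nat.cast_sub hd]
      congr 1
      push_cast
      ring
  rw [← key, IntegrableOn,
    ← hasFiniteIntegral_iff_ofReal (Eventually.of_forall fun p ↦ by positivity), Integrable,
    and_iff_right (measurable_norm.pow_const s).aestronglyMeasurable]

lemma lintegral_posLog_div_lt_top {δ : ℝ} (hδ : 0 < δ) :
    ∫⁻ p : E, ENNReal.ofReal (Real.posLog (δ / ‖p‖)) ∂μ < ⊤ := by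
  have hle : ∀ p : E, ENNReal.ofReal (Real.posLog (δ / ‖p‖)) ≤ (Metric.ball (0:E) δ).indicator
      (fun p ↦ ENNReal.ofReal (2 * δ ^ (1 / 2 : ℝ)) * ENNReal.ofReal (‖p‖ ^ (-(1 / 2) : ℝ))) p := by
    intro p
    by_cases hp : ‖p‖ < δ
    · rw [Set.indicator_of_mem (by simpa using hp), ← ENNReal.ofReal_mul (by positivity)]
      refine ENNReal.ofReal_le_ofReal (max_le (by positivity) ?_)
      refine (Real.log_le_rpow_div (ε := 1 / 2) (by positivity) (by norm_num)).trans_eq ?_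
      rw [Real.div_rpow hδ.le (norm_nonneg p), Real.rpow_neg (norm_nonneg p)]
      ring
    · have hp' : 0 < ‖p‖ := hδ.trans_le (not_lt.1 hp)
      have : Real.posLog (δ / ‖p‖) = 0 := by
        rw [Real.posLog_eq_zero_iff, abs_of_nonneg (by positivity)]
        exact (div_le_one hp').2 (not_lt.1 hp)
      simp [this]
  refine (lintegral_mono hle).trans_lt ?_
  rw [lintegral_indicator measurableSet_ball, lintegral_const_mul' _ _ ENNReal.ofReal_ne_top]
  have hd : (1:ℝ) ≤ Module.finrank ℝ E := by exact_mod_cast (Module.finrank_pos : 0 < _)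
  exact ENNReal.mul_lt_top ENNReal.ofReal_lt_top
    ((lintegral_ball_norm_rpow_lt_top_iff μ hδ _).2 (by linarith))

end

lemma lintegral_posLog_div_pos {δ : ℝ} (hδ : 0 < δ) :
    0 < ∫⁻ p : ℂ, ENNReal.ofReal (Real.posLog (δ / ‖p‖)) := by
  have hm : Measurable fun p : ℂ ↦ ENNReal.ofReal (Real.posLog (δ / ‖p‖)) := by
    unfold Real.posLog; fun_prop
  rw [lintegral_pos_iff_support hm]
  refine lt_of_lt_of_le ?_ (measure_mono (s := Metric.ball (0:ℂ) δ \ {0}) fun p hp ↦ ?_)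
  · rw [measure_sdiff_null (by simp)]
    exact Metric.measure_ball_pos _ _ hδ
  · have hp0 : 0 < ‖p‖ := norm_pos_iff.2 hp.2
    have hp1 : ‖p‖ < δ := by simpa using hp.1
    simp only [Function.mem_support, ne_eq, ENNReal.ofReal_eq_zero, not_le]
    exact lt_max_of_lt_right (Real.log_pos ((one_lt_div hp0).2 hp1))

lemma IsLogRadial.radialKernel_eq_zero {μ : Measure ℂ} {ρ : ℝ} (h : IsLogRadial μ ρ)
    (hρ : 0 ≤ ρ) {p : ℂ}
    (hp : ρ ≤ ‖p‖) : radialKernel μ p = 0 := by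
  refine le_antisymm ((h.radialKernel_le p).trans ?_) zero_le
  rw [nonpos_iff_eq_zero, ENNReal.ofReal_eq_zero]
  refine (Real.posLog_eq_zero_iff _).2 ?_ |>.le
  rw [abs_of_nonneg (by positivity)]
  exact div_le_one_of_le₀ hp (norm_nonneg p)

lemma lintegral_radialKernel_lt_top {μ : Measure ℂ} {ρ : ℝ} (h : IsLogRadial μ ρ) (hρ : 0 < ρ) :
    ∫⁻ p, radialKernel μ p < ⊤ :=
  (lintegral_mono h.radialKernel_le).trans_lt (lintegral_posLog_div_lt_top volume hρ)

lemma lintegral_discProb_eq_setLIntegral (w : ℂ → ℝ≥0∞) (z : ℂ) (r : ℝ) :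
    ∫⁻ q, w (z + q) ∂(discProb r) =
      (volume (Metric.ball (0:ℂ) r))⁻¹ * ∫⁻ y in Metric.ball z r, w y := by
  rw [discProb, lintegral_smul_measure, smul_eq_mul, ← lintegral_indicator measurableSet_ball,
    ← lintegral_indicator measurableSet_ball,
    ← lintegral_add_left_eq_self ((Metric.ball z r).indicator w) z]
  congr 2
  ext q
  simp [Set.indicator]

lemma lintegral_discProb_le_of_subset (w : ℂ → ℝ≥0∞) {z z' : ℂ} {r r' : ℝ} (hr : 0 < r)
    (hr' : 0 < r') (h : Metric.ball z r ⊆ Metric.ball z' r') :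
    ∫⁻ q, w (z + q) ∂(discProb r) ≤
      ENNReal.ofReal ((r' / r) ^ 2) * ∫⁻ q, w (z' + q) ∂(discProb r') := by
  have key : (volume (Metric.ball (0:ℂ) r))⁻¹ =
      ENNReal.ofReal ((r' / r) ^ 2) * (volume (Metric.ball (0:ℂ) r'))⁻¹ := by
    have hpi : (0:ℝ) < Real.pi := Real.pi_pos
    have e : ∀ s : ℝ, 0 < s → (volume (Metric.ball (0:ℂ) s))⁻¹ =
        ENNReal.ofReal ((s ^ 2 * Real.pi)⁻¹) := fun s hs ↦ by
      rw [Complex.volume_ball, ENNReal.ofReal_inv_of_pos (by positivity),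
        ENNReal.ofReal_mul (by positivity), ENNReal.ofReal_pow hs.le]
      congr 2
      exact (ENNReal.ofReal_eq_coe_nnreal hpi.le).symm
    rw [e r hr, e r' hr', ← ENNReal.ofReal_mul (by positivity)]
    congr 1
    field_simp
  rw [lintegral_discProb_eq_setLIntegral, lintegral_discProb_eq_setLIntegral, key, mul_assoc]
  gcongr

/-- Bounded measurable functions with the super-mean value property in the closed disc of
radius `R` about the origin. -/
structure SuperMean (w : ℂ → ℝ≥0∞) (R : ℝ) : Prop where
  measurable : Measurable w
  bounded : ∃ M : ℝ≥0∞, M ≠ ⊤ ∧ ∀ z, w z ≤ M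
  supermean : ∀ z r, 0 ≤ r → ‖z‖ + r ≤ R → ∫⁻ q, w (z + q) ∂(circleProb r) ≤ w z

/-- The defect in the super-mean value inequality on circles of radius `δ`. -/
def meanDefect (w : ℂ → ℝ≥0∞) (δ : ℝ) (z : ℂ) : ℝ≥0∞ :=
  w z - ∫⁻ q, w (z + q) ∂(circleProb δ)

lemma measurable_lintegral_add {w : ℂ → ℝ≥0∞} (hw : Measurable w) (μ : Measure ℂ) [SFinite μ] :
    Measurable fun z ↦ ∫⁻ q, w (z + q) ∂μ :=
  Measurable.lintegral_prod_right' (f := fun x : ℂ × ℂ ↦ w (x.1 + x.2)) (by fun_prop)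

lemma lintegral_add_le_of_le {w : ℂ → ℝ≥0∞} {M : ℝ≥0∞} (hM : ∀ z, w z ≤ M) (μ : Measure ℂ)
    [IsProbabilityMeasure μ] (z : ℂ) : ∫⁻ q, w (z + q) ∂μ ≤ M := by
  refine (lintegral_mono fun q ↦ hM (z + q)).trans ?_
  simp

namespace SuperMean

variable {w : ℂ → ℝ≥0∞} {R : ℝ}

lemma measurable_meanDefect (hw : SuperMean w R) (δ : ℝ) : Measurable (meanDefect w δ) :=
  hw.measurable.sub (measurable_lintegral_add hw.measurable _)

lemma disc_supermean (hw : SuperMean w R) {z : ℂ} {r : ℝ} (hr : 0 < r) (hz : ‖z‖ + r ≤ R) :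
    ∫⁻ q, w (z + q) ∂(discProb r) ≤ w z := by
  have := isProbabilityMeasure_discProb hr
  rw [lintegral_discProb hw.measurable]
  calc _ ≤ ∫⁻ _, w z ∂(discProb r) := by
        refine lintegral_mono_ae ?_
        filter_upwards [ae_discProb r] with q hq
        exact hw.supermean z _ (norm_nonneg q) (by linarith)
    _ = w z := by simp

/-- The Riesz decomposition of a smoothed super-mean function. -/
lemma riesz (hw : SuperMean w R) {μ : Measure ℂ} {ρ δ : ℝ} (hμ : IsLogRadial μ ρ) (hρ : 0 < ρ)
    (hδ : 0 < δ) {z : ℂ} (hz : ‖z‖ + ρ + δ ≤ R) :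
    (∫⁻ p, radialKernel μ p * meanDefect w δ (z + p)) +
        (∫⁻ p, radialKernel (circleProb δ) p * ∫⁻ q, w (z + p + q) ∂μ) =
      ∫⁻ p, radialKernel (circleProb δ) p * w (z + p) := by
  have := hμ.prob
  obtain ⟨M, hM, hwM⟩ := hw.bounded
  have hS := measurable_lintegral_add hw.measurable (circleProb δ)
  have hJ := measurable_radialKernel μ
  have h1 : ∫⁻ p, radialKernel μ p * w (z + p) =
      (∫⁻ p, radialKernel μ p * ∫⁻ q, w (z + p + q) ∂(circleProb δ)) +
        ∫⁻ p, radialKernel μ p * meanDefect w δ (z + p) := by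
    have hm : Measurable fun p ↦ radialKernel μ p * ∫⁻ q, w (z + p + q) ∂(circleProb δ) :=
      hJ.mul (hS.comp (measurable_const_add z))
    rw [← lintegral_add_left hm]
    refine lintegral_congr fun p ↦ ?_
    rcases le_or_gt ρ ‖p‖ with hp | hp
    · simp [hμ.radialKernel_eq_zero hρ.le hp]
    · rw [← mul_add, meanDefect, add_tsub_cancel_of_le]
      exact hw.supermean _ _ hδ.le (by linarith [norm_add_le z p])
  have h2 := hμ.conv_comm (isLogRadial_circleProb hδ) hw.measurable z
  have hfin : ∫⁻ p, radialKernel μ p * ∫⁻ q, w (z + p + q) ∂(circleProb δ) ≠ ⊤ := by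
    refine ne_top_of_le_ne_top (b := (∫⁻ p, radialKernel μ p) * M) ?_ ?_
    · exact ENNReal.mul_ne_top (lintegral_radialKernel_lt_top hμ hρ).ne hM
    · rw [← lintegral_mul_const _ hJ]
      gcongr
      exact lintegral_add_le_of_le hwM _ _
  rw [h1, add_assoc, add_comm (∫⁻ p, radialKernel (circleProb δ) p * w (z + p))] at h2
  exact (ENNReal.add_right_inj hfin).1 h2

lemma lintegral_radialKernel_mul_le {δ : ℝ} (hδ : 0 < δ) {F : ℂ → ℝ≥0∞} {K : ℝ≥0∞}
    (hF : ∀ p, ‖p‖ < δ → F p ≤ K) :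
    ∫⁻ p, radialKernel (circleProb δ) p * F p ≤ (∫⁻ p, radialKernel (circleProb δ) p) * K := by
  rw [← lintegral_mul_const _ (measurable_radialKernel _)]
  refine lintegral_mono fun p ↦ ?_
  rcases le_or_gt δ ‖p‖ with hp | hp
  · simp [(isLogRadial_circleProb hδ).radialKernel_eq_zero hδ.le hp]
  · gcongr
    exact hF p hp

lemma le_lintegral_radialKernel_mul {δ : ℝ} (hδ : 0 < δ) {F : ℂ → ℝ≥0∞} {K : ℝ≥0∞}
    (hF : ∀ p, ‖p‖ < δ → K ≤ F p) :
    (∫⁻ p, radialKernel (circleProb δ) p) * K ≤ ∫⁻ p, radialKernel (circleProb δ) p * F p := by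
  rw [← lintegral_mul_const _ (measurable_radialKernel _)]
  refine lintegral_mono fun p ↦ ?_
  rcases le_or_gt δ ‖p‖ with hp | hp
  · simp [(isLogRadial_circleProb hδ).radialKernel_eq_zero hδ.le hp]
  · gcongr
    exact hF p hp

lemma meanDefect_mass_le (hw : SuperMean w R) {ρ₁ ρ₂ δ : ℝ} (h1 : 0 < ρ₁) (h12 : ρ₁ < ρ₂)
    (hδ : 0 < δ) (hR : ρ₂ + δ ≤ R) {K : ℝ≥0∞}
    (hK : ∀ p, ‖p‖ < δ → ∫⁻ q, w (p + q) ∂(discProb ρ₁) ≤ K) :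
    ENNReal.ofReal (Real.log (ρ₂ / ρ₁)) * ∫⁻ p in Metric.ball 0 ρ₁, meanDefect w δ p ≤
      (∫⁻ p, radialKernel (circleProb δ) p) * K := by
  have hμ₁ := isLogRadial_discProb h1
  have hμ₂ := isLogRadial_circleProb (h1.trans h12)
  have r1 := hw.riesz (z := 0) hμ₁ h1 hδ (by simp; linarith)
  have r2 := hw.riesz (z := 0) hμ₂ (h1.trans h12) hδ (by simpa using hR)
  simp only [zero_add] at r1 r2
  obtain ⟨M, hM, hwM⟩ := hw.bounded
  have hΔM : ∀ p, meanDefect w δ p ≤ M := fun p ↦ tsub_le_self.trans (hwM p)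
  have hJ := measurable_radialKernel (discProb ρ₁)
  have hΔ := hw.measurable_meanDefect δ
  have hfin : ∫⁻ p, radialKernel (discProb ρ₁) p * meanDefect w δ p ≠ ⊤ := by
    refine ne_top_of_le_ne_top (b := (∫⁻ p, radialKernel (discProb ρ₁) p) * M) ?_ ?_
    · exact ENNReal.mul_ne_top (lintegral_radialKernel_lt_top hμ₁ h1).ne hM
    · rw [← lintegral_mul_const _ hJ]
      gcongr
      exact hΔM _
  refine le_trans ?_ (lintegral_radialKernel_mul_le hδ hK)
  refine (ENNReal.add_le_add_iff_left hfin).1 ?_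
  rw [r1]
  refine le_trans ?_ (le_self_add.trans r2.le)
  have hJΔ : Measurable fun p ↦ radialKernel (discProb ρ₁) p * meanDefect w δ p := hJ.mul hΔ
  rw [← lintegral_const_mul _ hΔ, ← lintegral_indicator measurableSet_ball,
    ← lintegral_add_left hJΔ]
  refine lintegral_mono_ae ?_
  filter_upwards [compl_mem_ae_iff.2 (measure_singleton (0:ℂ))] with p hp
  have hp0 : 0 < ‖p‖ := norm_pos_iff.2 hp
  by_cases hp1 : ‖p‖ < ρ₁
  · rw [Set.indicator_of_mem (by simpa using hp1), ← add_mul]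
    gcongr
    rw [radialKernel_circleProb (h1.trans h12).le]
    refine (add_le_add_left (hμ₁.radialKernel_le p) _).trans ?_
    have l1 : 1 ≤ ρ₁ / ‖p‖ := (one_le_div hp0).2 hp1.le
    have l2 : 1 ≤ ρ₂ / ‖p‖ := (one_le_div hp0).2 (hp1.trans h12).le
    rw [Real.posLog_eq_log (l1.trans (le_abs_self _)),
      Real.posLog_eq_log (l2.trans (le_abs_self _)),
      ← ENNReal.ofReal_add (Real.log_nonneg l1) (Real.log_nonneg ((one_le_div h1).2 h12.le)),
      Real.log_div h1.ne' hp0.ne', Real.log_div (h1.trans h12).ne' hp0.ne',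
      Real.log_div (h1.trans h12).ne' h1.ne']
    exact ENNReal.ofReal_le_ofReal (by linarith)
  · rw [Set.indicator_of_notMem (by simpa using hp1),
      hμ₁.radialKernel_eq_zero h1.le (not_lt.1 hp1)]
    simp

lemma le_add_potential (hw : SuperMean w R) {ρ δ : ℝ} (hρ : 0 < ρ) (hδ : 0 < δ) {z : ℂ}
    {ρ₁ : ℝ} (hz : ‖z‖ + ρ ≤ ρ₁) (hzR : ‖z‖ + ρ + δ ≤ R) {m C : ℝ≥0∞}
    (hm : ∀ p, ‖p‖ < δ → m ≤ w (z + p))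
    (hC : ∀ p, ‖p‖ < δ → ∫⁻ q, w (z + p + q) ∂(discProb ρ) ≤ C) :
    m ≤ C + ∫⁻ y, ENNReal.ofReal (Real.posLog (ρ / ‖z - y‖))
      ∂((∫⁻ p, radialKernel (circleProb δ) p)⁻¹ •
        (volume.restrict (Metric.ball 0 ρ₁)).withDensity (meanDefect w δ)) := by
  have hμ := isLogRadial_discProb hρ
  have hΔ := hw.measurable_meanDefect δ
  set c := ∫⁻ p, radialKernel (circleProb δ) p with hc
  have hc0 : c ≠ 0 := by
    simp_rw [hc, radialKernel_circleProb hδ.le]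
    exact (lintegral_posLog_div_pos hδ).ne'
  have hct : c ≠ ⊤ := (lintegral_radialKernel_lt_top (isLogRadial_circleProb hδ) hδ).ne
  have r := hw.riesz hμ hρ hδ hzR
  have e1 : c * m ≤ _ := le_lintegral_radialKernel_mul hδ hm
  have e2 : _ ≤ c * C := lintegral_radialKernel_mul_le hδ hC
  have hpos : Measurable fun y : ℂ ↦ ENNReal.ofReal (Real.posLog (ρ / ‖z - y‖)) := by
    unfold Real.posLog; fun_prop
  have e3 : ∫⁻ p, radialKernel (discProb ρ) p * meanDefect w δ (z + p) ≤
      ∫⁻ y, ENNReal.ofReal (Real.posLog (ρ / ‖z - y‖))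
        ∂(volume.restrict (Metric.ball 0 ρ₁)).withDensity (meanDefect w δ) := by
    rw [lintegral_withDensity_eq_lintegral_mul _ hΔ hpos, ← lintegral_indicator measurableSet_ball,
      ← lintegral_add_left_eq_self (Set.indicator _ _) z]
    refine lintegral_mono fun p ↦ ?_
    rcases le_or_gt ρ ‖p‖ with hp | hp
    · simp [hμ.radialKernel_eq_zero hρ.le hp]
    · rw [Set.indicator_of_mem (by simpa using (norm_add_le z p).trans_lt (by linarith))]
      simp only [Pi.mul_apply, sub_add_cancel_left, norm_neg]
      rw [mul_comm]
      gcongr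
      exact hμ.radialKernel_le p
  have e4 : c * m ≤ c * (C + c⁻¹ * ∫⁻ y, ENNReal.ofReal (Real.posLog (ρ / ‖z - y‖))
        ∂(volume.restrict (Metric.ball 0 ρ₁)).withDensity (meanDefect w δ)) := by
    rw [mul_add, ← mul_assoc, ENNReal.mul_inv_cancel hc0 hct, one_mul]
    calc c * m ≤ _ := e1
      _ = _ := r.symm
      _ ≤ _ := add_le_add e3 e2
      _ = _ := add_comm _ _
  rw [lintegral_smul_measure, smul_eq_mul]
  exact (ENNReal.mul_le_mul_iff_right hc0 hct).1 e4

end SuperMean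

/-- The truncated potential `B - log f`, as an extended nonnegative function. -/
def truncPot (f : ℂ → ℝ) (B c : ℝ) (z : ℂ) : ℝ≥0∞ :=
  ENNReal.ofReal (B - truncLog f c z)

namespace LogSubharmonic

variable {f : ℂ → ℝ}

lemma superMean_truncPot (hf : LogSubharmonic f) {B c R : ℝ}
    (hB : ∀ z, ‖z‖ ≤ R → truncLog f c z ≤ B) : SuperMean (truncPot f B c) R := by
  have hm := truncLog_measurable hf.usc c
  refine ⟨(measurable_const.sub hm).ennreal_ofReal, ⟨ENNReal.ofReal (B - c),
    ENNReal.ofReal_ne_top, fun z ↦ ENNReal.ofReal_le_ofReal ?_⟩, fun z r hr hz ↦ ?_⟩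
  · linarith [le_truncLog f c z]
  · have hi := truncLog_circleIntegrable hf.usc c z r
    have hi' : CircleIntegrable (fun w ↦ B - truncLog f c w) z r :=
      (circleIntegrable_const B z r).sub hi
    refine (lintegral_circleProb (g := fun w ↦ B - truncLog f c w)
      (measurable_const.sub hm) z r hi' fun w hw ↦ ?_).trans_le ?_
    · rw [abs_of_nonneg hr, mem_sphere_iff_norm] at hw
      have : ‖w‖ ≤ ‖z‖ + ‖w - z‖ := by simpa using norm_add_le z (w - z)
      linarith [hB w (by linarith)]
    · refine ENNReal.ofReal_le_ofReal ?_
      have e : Real.circleAverage (fun w ↦ B - truncLog f c w) z r =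
          B - Real.circleAverage (truncLog f c) z r := by
        have := Real.circleAverage_fun_sub (circleIntegrable_const B z r) hi
        simpa [Real.circleAverage_const] using this
      rw [e]
      rcases hr.eq_or_lt with rfl | hr
      · simp
      · linarith [hf.submean c z r hr]

lemma truncPot_disc_le (hf : LogSubharmonic f) {B c R : ℝ}
    (hB : ∀ z, ‖z‖ ≤ R → truncLog f c z ≤ B) {a p : ℂ} {r ρ : ℝ} (hρ : 0 < ρ) (hr : 0 < r)
    (ha : 0 < f a) (haR : ‖a‖ + r ≤ R) (hsub : ‖p - a‖ + ρ ≤ r) :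
    ∫⁻ q, truncPot f B c (p + q) ∂(discProb ρ) ≤
      ENNReal.ofReal ((r / ρ) ^ 2 * (B - Real.log (f a))) := by
  have hw := hf.superMean_truncPot hB
  refine (lintegral_discProb_le_of_subset _ hρ hr
    (Metric.ball_subset_ball' (by rw [dist_eq_norm]; linarith) :
      Metric.ball p ρ ⊆ Metric.ball a r)).trans ?_
  rw [ENNReal.ofReal_mul (by positivity)]
  gcongr
  refine (hw.disc_supermean hr haR).trans (ENNReal.ofReal_le_ofReal ?_)
  linarith [log_le_truncLog c ha]

lemma exists_potential (hf : LogSubharmonic f) {R ρ₁ ρ₂ B κ δ₀ : ℝ} (h1 : 0 < ρ₁)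
    (h12 : ρ₁ < ρ₂) (h2 : ρ₂ < R) (hB0 : 0 ≤ B)
    (hB : ∀ c ≤ 0, ∀ z, ‖z‖ ≤ R → truncLog f c z ≤ B) (hδ₀ : 0 < δ₀) (hκ : 0 ≤ κ)
    (hK : ∀ c ≤ 0, ∀ p, ‖p‖ < δ₀ → ∫⁻ q, truncPot f B c (p + q) ∂(discProb ρ₁) ≤
      ENNReal.ofReal (κ * Real.log (ρ₂ / ρ₁))) :
    ∃ C : ℝ≥0∞, C ≠ ⊤ ∧ ∃ ν : ℕ → Measure ℂ, (∀ n, ν n Set.univ ≤ ENNReal.ofReal κ) ∧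
      ∀ z, ‖z‖ < ρ₁ / 4 → ∀ t, f z < Real.exp t → ∀ᶠ n in atTop, ENNReal.ofReal (-t) ≤
        C + ∫⁻ y, ENNReal.ofReal (Real.posLog (ρ₁ / 2 / ‖z - y‖)) ∂(ν n) := by
  set δ₁ := min δ₀ (min (ρ₁ / 4) (R - ρ₂)) with hδ₁
  have hδ₁0 : 0 < δ₁ := by
    refine lt_min hδ₀ (lt_min ?_ ?_) <;> linarith
  have hδ₁a : δ₁ ≤ δ₀ := min_le_left _ _
  have hδ₁b : δ₁ ≤ ρ₁ / 4 := (min_le_right _ _).trans (min_le_left _ _)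
  have hδ₁c : δ₁ ≤ R - ρ₂ := (min_le_right _ _).trans (min_le_right _ _)
  let δ : ℕ → ℝ := fun n ↦ δ₁ / (n + 1)
  have hδ0 : ∀ n, 0 < δ n := fun n ↦ by positivity
  have hδle : ∀ n, δ n ≤ δ₁ := fun n ↦
    div_le_self hδ₁0.le (by have : (0:ℝ) ≤ n := n.cast_nonneg; linarith)
  have hδlim : Tendsto δ atTop (𝓝 0) := 
    tendsto_const_nhds.div_atTop (tendsto_natCast_atTop_atTop.atTop_add tendsto_const_nhds)
  have hw : ∀ n : ℕ, SuperMean (truncPot f B (-n)) R := fun n ↦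
    hf.superMean_truncPot (hB _ (by simp))
  have hL : 0 < Real.log (ρ₂ / ρ₁) := Real.log_pos ((one_lt_div h1).2 h12)
  refine ⟨ENNReal.ofReal ((ρ₁ / (ρ₁ / 2)) ^ 2) * ENNReal.ofReal (κ * Real.log (ρ₂ / ρ₁)),
    ENNReal.mul_ne_top ENNReal.ofReal_ne_top ENNReal.ofReal_ne_top,
    fun n ↦ (∫⁻ p, radialKernel (circleProb (δ n)) p)⁻¹ •
      (volume.restrict (Metric.ball 0 ρ₁)).withDensity (meanDefect (truncPot f B (-n)) (δ n)),
    fun n ↦ ?_, fun z hz t ht ↦ ?_⟩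
  · set c := ∫⁻ p, radialKernel (circleProb (δ n)) p with hc
    have hc0 : c ≠ 0 := by
      simp_rw [hc, radialKernel_circleProb (hδ0 n).le]
      exact (lintegral_posLog_div_pos (hδ0 n)).ne'
    have hct : c ≠ ⊤ :=
      (lintegral_radialKernel_lt_top (isLogRadial_circleProb (hδ0 n)) (hδ0 n)).ne
    have key := (hw n).meanDefect_mass_le h1 h12 (hδ0 n) (by linarith [hδle n])
      fun p hp ↦ hK _ (by simp) p (hp.trans_le ((hδle n).trans hδ₁a))
    rw [ENNReal.ofReal_mul hκ, mul_comm (ENNReal.ofReal κ), mul_left_comm,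
      ENNReal.mul_le_mul_iff_right (by simpa using hL) ENNReal.ofReal_ne_top] at key
    rw [Measure.smul_apply, withDensity_apply _ MeasurableSet.univ, Measure.restrict_univ,
      smul_eq_mul, mul_comm, ← div_eq_mul_inv]
    exact ENNReal.div_le_of_le_mul' key
  · obtain ⟨ε, hε, hball⟩ := Metric.eventually_nhds_iff.1 (hf.usc z _ ht)
    obtain ⟨N, hN⟩ := exists_nat_ge (-t)
    filter_upwards [hδlim.eventually_lt_const hε, eventually_ge_atTop N] with n hn hnN
    have hnN' : (N:ℝ) ≤ n := by exact_mod_cast hnN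
    refine (hw n).le_add_potential (by linarith) (hδ0 n) (by linarith)
      (by linarith [hδle n]) (fun p hp ↦ ?_) fun p hp ↦ ?_
    · refine ENNReal.ofReal_le_ofReal ?_
      have : truncLog f (-n) (z + p) ≤ t :=
        truncLog_le_iff.2 ⟨(hball (by simpa using hp.trans hn)).le, by linarith⟩
      linarith
    · refine (lintegral_discProb_le_of_subset (z' := 0) _ (by linarith) h1
        (Metric.ball_subset_ball' ?_)).trans ?_
      · rw [dist_zero_right]
        linarith [norm_add_le z p, hδle n]
      · gcongr
        exact hK _ (by simp) 0 (by simpa using hδ₀)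

end LogSubharmonic

/-- The kernel `log⁺ (ρ / |x|)` with value `∞` at the origin. -/
def lineKernel (ρ x : ℝ) : ℝ≥0∞ :=
  if x = 0 then ⊤ else ENNReal.ofReal (Real.posLog (ρ / |x|))

lemma measurable_lineKernel (ρ : ℝ) : Measurable (lineKernel ρ) := by
  unfold lineKernel Real.posLog
  exact Measurable.ite (measurableSet_singleton 0) measurable_const (by fun_prop)

lemma lintegral_lineKernel_lt_top {ρ : ℝ} (hρ : 0 < ρ) : ∫⁻ x, lineKernel ρ x < ⊤ := by
  refine lt_of_eq_of_lt (lintegral_congr_ae ?_)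
    (lintegral_posLog_div_lt_top (E := ℝ) volume hρ)
  filter_upwards [compl_mem_ae_iff.2 (measure_singleton (0:ℝ))] with x hx
  rw [lineKernel, if_neg (by simpa using hx), Real.norm_eq_abs]

lemma posLog_le_lineKernel {ρ : ℝ} (hρ : 0 < ρ) (z y : ℂ) :
    ENNReal.ofReal (Real.posLog (ρ / ‖z - y‖)) ≤ lineKernel ρ (‖z‖ - ‖y‖) := by
  rw [lineKernel]
  split_ifs with h
  · exact le_top
  · refine ENNReal.ofReal_le_ofReal (Real.posLog_le_posLog (by positivity) ?_)
    have : 0 < |‖z‖ - ‖y‖| := abs_pos.2 h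
    gcongr
    exact abs_norm_sub_norm_le z y

namespace LogSubharmonic

variable {f : ℂ → ℝ}

lemma exists_circle_pos (hf : LogSubharmonic f) {ε : ℝ} (hε : 0 < ε) :
    ∃ r, 0 < r ∧ r < ε ∧ ∀ z, ‖z‖ = r → 0 < f z := by
  obtain ⟨a, ha⟩ := hf.nontrivial
  have ha : 0 < f a := (hf.nonneg a).lt_of_ne' ha
  obtain ⟨B, hB0, hB⟩ := exists_truncLog_le hf.usc (isCompact_closedBall (0:ℂ) (2 * ‖a‖ + 3))
  have hB : ∀ c ≤ 0, ∀ z, ‖z‖ ≤ 2 * ‖a‖ + 3 → truncLog f c z ≤ B :=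
    fun c hc z hz ↦ hB c hc z (by simpa using hz)
  have hl2 : 0 < Real.log (2 / 1) := Real.log_pos (by norm_num)
  set κ := max 0 (((‖a‖ + 2) / 1) ^ 2 * (B - Real.log (f a))) / Real.log (2 / 1) with hκ
  have hna := norm_nonneg a
  obtain ⟨C, hC, ν, hν, hpot⟩ := hf.exists_potential (κ := κ) one_pos one_lt_two
    (by linarith : (2:ℝ) < 2 * ‖a‖ + 3) hB0 hB one_pos (by positivity) (fun c hc p hp ↦ by
      refine (hf.truncPot_disc_le (hB c hc) one_pos (r := ‖a‖ + 2) (by positivity) ha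
        (by linarith) ?_).trans (ENNReal.ofReal_le_ofReal ?_)
      · linarith [norm_sub_le p a]
      · rw [hκ, div_mul_cancel₀ _ hl2.ne']
        exact le_max_right _ _)
  have hfin : ∀ n, IsFiniteMeasure (ν n) := fun n ↦ ⟨(hν n).trans_lt ENNReal.ofReal_lt_top⟩
  by_contra! hcon
  set η := min ε (1 / 4) with hη
  have hη0 : 0 < η := lt_min hε (by norm_num)
  let H : ℕ → ℝ → ℝ≥0∞ := fun n r ↦ ∫⁻ y, lineKernel (1 / 2) (r - ‖y‖) ∂(ν n)
  have hkm : Measurable fun x : ℝ × ℂ ↦ lineKernel (1 / 2) (x.1 - ‖x.2‖) :=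
    (measurable_lineKernel _).comp (by fun_prop)
  have hHm : ∀ n, Measurable (H n) := fun n ↦ hkm.lintegral_prod_right'
  have hH : ∀ r ∈ Set.Ioo 0 η, liminf (fun n ↦ H n r) atTop = ⊤ := by
    intro r hr
    obtain ⟨z, hz, hfz⟩ := hcon r hr.1 (hr.2.trans_le (min_le_left _ _))
    refine ENNReal.eq_top_of_forall_nnreal_le fun s ↦ le_liminf_of_le (by isBoundedDefault) ?_
    lift C to ℝ≥0 using hC
    filter_upwards [hpot z (by rw [hz]; exact hr.2.trans_le (min_le_right _ _)) (-(C + s))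
      (hfz.trans_lt (Real.exp_pos _))] with n hn
    rw [neg_neg, ← NNReal.coe_add, ENNReal.ofReal_coe_nnreal, ENNReal.coe_add,
      ENNReal.add_le_add_iff_left ENNReal.coe_ne_top] at hn
    refine hn.trans (lintegral_mono fun y ↦ ?_)
    rw [← hz]
    exact posLog_le_lineKernel (by norm_num) z y
  have hle : ∀ n, ∫⁻ r in Set.Ioo 0 η, H n r ≤
      ENNReal.ofReal κ * ∫⁻ x, lineKernel (1 / 2) x := by
    intro n
    calc ∫⁻ r in Set.Ioo 0 η, H n r ≤ ∫⁻ r, H n r := setLIntegral_le_lintegral _ _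
      _ = ∫⁻ y, (∫⁻ r, lineKernel (1 / 2) (r - ‖y‖)) ∂(ν n) :=
        lintegral_lintegral_swap hkm.aemeasurable
      _ = ∫⁻ _, (∫⁻ x, lineKernel (1 / 2) x) ∂(ν n) :=
        lintegral_congr fun y ↦ lintegral_sub_right_eq_self _ _
      _ ≤ _ := by
        rw [lintegral_const, mul_comm]
        gcongr
        exact hν n
  have htop : ∫⁻ r in Set.Ioo 0 η, liminf (fun n ↦ H n r) atTop = ⊤ := by
    rw [setLIntegral_congr_fun measurableSet_Ioo hH, lintegral_const, Measure.restrict_apply_univ,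
      Real.volume_Ioo, ENNReal.top_mul (by simpa using hη0)]
  have hfatou := lintegral_liminf_le (u := atTop) (μ := volume.restrict (Set.Ioo 0 η)) hHm
  rw [htop, top_le_iff] at hfatou
  have hb : ENNReal.ofReal κ * ∫⁻ x, lineKernel (1 / 2) x < ⊤ :=
    ENNReal.mul_lt_top ENNReal.ofReal_lt_top (lintegral_lineKernel_lt_top (by norm_num))
  refine (hfatou.symm.trans_le ?_).not_gt hb
  exact liminf_le_of_le (by isBoundedDefault) fun b hb ↦ (hb.exists).choose_spec.trans (hle _)

end LogSubharmonic

lemma ofReal_exp_posLog_le {ρ α : ℝ} (hρ : 0 < ρ) (x : ℂ) :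
    ENNReal.ofReal (Real.exp (α * Real.posLog (ρ / ‖x‖))) ≤
      1 + (Metric.ball (0:ℂ) ρ).indicator
        (fun x ↦ ENNReal.ofReal (ρ ^ α) * ENNReal.ofReal (‖x‖ ^ (-α))) x := by
  rcases eq_or_ne x 0 with rfl | hx
  · simp
  have hx0 : 0 < ‖x‖ := norm_pos_iff.2 hx
  rcases lt_or_ge ‖x‖ ρ with h | h
  · rw [Set.indicator_of_mem (by simpa using h), ← ENNReal.ofReal_mul (by positivity)]
    refine le_trans (ENNReal.ofReal_le_ofReal (le_of_eq ?_)) le_add_self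
    have h1 : 1 ≤ ρ / ‖x‖ := (one_le_div hx0).2 h.le
    rw [Real.posLog_eq_log (h1.trans (le_abs_self _)), mul_comm,
      ← Real.rpow_def_of_pos (by positivity), Real.div_rpow hρ.le hx0.le,
      Real.rpow_neg hx0.le, div_eq_mul_inv]
  · have : Real.posLog (ρ / ‖x‖) = 0 := by
      rw [Real.posLog_eq_zero_iff, abs_of_nonneg (by positivity)]
      exact (div_le_one hx0).2 h
    simp [this]

lemma lintegral_exp_posLog_le {ρ α : ℝ} (hρ : 0 < ρ) (hα : α < 2) (r : ℝ) :
    ∃ Q : ℝ≥0∞, Q ≠ ⊤ ∧ ∀ y : ℂ, ∫⁻ z in Metric.ball (0:ℂ) r,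
      ENNReal.ofReal (Real.exp (α * Real.posLog (ρ / ‖z - y‖))) ≤ Q := by
  let G : ℂ → ℝ≥0∞ := (Metric.ball (0:ℂ) ρ).indicator
    fun x ↦ ENNReal.ofReal (ρ ^ α) * ENNReal.ofReal (‖x‖ ^ (-α))
  refine ⟨volume (Metric.ball (0:ℂ) r) + ∫⁻ x, G x, ?_, fun y ↦ ?_⟩
  · refine ENNReal.add_ne_top.2 ⟨measure_ball_lt_top.ne, ?_⟩
    rw [lintegral_indicator measurableSet_ball, lintegral_const_mul' _ _ ENNReal.ofReal_ne_top]
    refine ENNReal.mul_ne_top ENNReal.ofReal_ne_top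
      ((lintegral_ball_norm_rpow_lt_top_iff volume hρ _).2 ?_).ne
    rw [Complex.finrank_real_complex]
    push_cast
    linarith
  · calc _ ≤ ∫⁻ z in Metric.ball (0:ℂ) r, 1 + G (z - y) :=
          lintegral_mono fun z ↦ ofReal_exp_posLog_le hρ _
      _ = volume (Metric.ball (0:ℂ) r) + ∫⁻ z in Metric.ball (0:ℂ) r, G (z - y) := by
        rw [lintegral_add_left measurable_const, setLIntegral_one]
      _ ≤ _ := by
        refine add_le_add le_rfl ((setLIntegral_le_lintegral _ _).trans_eq ?_)
        exact lintegral_sub_right_eq_self G y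

/-- A form of Jensen's inequality for measures of mass at most `κ`. -/
lemma ofReal_exp_le_lintegral {X : Type*} [MeasurableSpace X] {ν : Measure X} {κ a m : ℝ}
    (hκ : 0 < κ) (ha : 0 < a) (hν : ν Set.univ ≤ ENNReal.ofReal κ) {g : X → ℝ}
    (hg : Measurable g) (hm : ENNReal.ofReal m ≤ ∫⁻ y, ENNReal.ofReal (g y) ∂ν) :
    ENNReal.ofReal (Real.exp (a * m)) ≤ ENNReal.ofReal (Real.exp 1) +
      (ENNReal.ofReal κ)⁻¹ * ∫⁻ y, ENNReal.ofReal (Real.exp (a * κ * g y)) ∂ν := by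
  rcases le_total (a * m) 1 with h | h
  · exact (ENNReal.ofReal_le_ofReal (Real.exp_le_exp.2 h)).trans le_self_add
  refine le_trans ?_ le_add_self
  have hm0 : 0 < m := by
    by_contra! hm0
    nlinarith
  set E := Real.exp (a * m) with hE
  have hE0 : 0 < E := Real.exp_pos _
  have pt : ∀ y, ENNReal.ofReal (E * (a * κ)) * ENNReal.ofReal (g y) ≤
      ENNReal.ofReal (Real.exp (a * κ * g y)) + ENNReal.ofReal (E * (a * m - 1)) := by
    intro y
    rw [← ENNReal.ofReal_mul (by positivity),
      ← ENNReal.ofReal_add (Real.exp_pos _).le (mul_nonneg hE0.le (by linarith))]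
    refine ENNReal.ofReal_le_ofReal ?_
    have h1 : Real.exp (a * κ * g y) = E * Real.exp (a * κ * g y - a * m) := by
      rw [hE, ← Real.exp_add]
      ring_nf
    have h2 := mul_le_mul_of_nonneg_left (Real.add_one_le_exp (a * κ * g y - a * m)) hE0.le
    rw [h1]
    linarith
  have int := lintegral_mono (μ := ν) pt
  rw [lintegral_const_mul _ hg.ennreal_ofReal, lintegral_add_right _ measurable_const,
    lintegral_const] at int
  set P := ∫⁻ y, ENNReal.ofReal (Real.exp (a * κ * g y)) ∂ν with hP
  have key : ENNReal.ofReal κ * ENNReal.ofReal E ≤ P := by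
    have h3 : ENNReal.ofReal (E * (a * κ)) * ENNReal.ofReal m ≤
        P + ENNReal.ofReal (E * (a * m - 1)) * ENNReal.ofReal κ :=
      (by gcongr : _ ≤ _).trans (int.trans (by gcongr))
    rw [← ENNReal.ofReal_mul (by positivity),
      ← ENNReal.ofReal_mul (mul_nonneg hE0.le (by linarith))] at h3
    refine (ENNReal.add_le_add_iff_right
      (ENNReal.ofReal_ne_top (r := E * (a * m - 1) * κ))).1 (le_trans (le_of_eq ?_) h3)
    rw [← ENNReal.ofReal_mul hκ.le, ← ENNReal.ofReal_add (by positivity)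
      (mul_nonneg (mul_nonneg hE0.le (by linarith)) hκ.le)]
    congr 1
    ring
  have hκ0 : ENNReal.ofReal κ ≠ 0 := by simpa using hκ
  calc ENNReal.ofReal E = (ENNReal.ofReal κ)⁻¹ * (ENNReal.ofReal κ * ENNReal.ofReal E) := by
        rw [← mul_assoc, ENNReal.inv_mul_cancel hκ0 ENNReal.ofReal_ne_top, one_mul]
    _ ≤ _ := by gcongr

lemma inv_pow_le_of_forall {x : ℝ} {L : ℝ≥0∞} {k : ℕ} (hk : k ≠ 0)
    (h : ∀ t, x < Real.exp t → ENNReal.ofReal (Real.exp (-(k * t))) ≤ L) :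
    (ENNReal.ofReal x)⁻¹ ^ k ≤ L := by
  have hk0 : (0:ℝ) < k := by positivity
  rw [← ENNReal.rpow_natCast, ← ENNReal.le_rpow_inv_iff hk0]
  refine ENNReal.le_of_forall_nnreal_lt fun s hs ↦ ?_
  rw [ENNReal.le_rpow_inv_iff hk0, ENNReal.rpow_natCast]
  rcases eq_or_ne s 0 with rfl | hs0
  · simp [hk]
  have hs0' : (0:ℝ) < s := NNReal.coe_pos.2 (pos_iff_ne_zero.2 hs0)
  have hx : x < (s:ℝ)⁻¹ := by
    by_contra! hx
    have := ENNReal.ofReal_le_ofReal hx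
    rw [ENNReal.ofReal_inv_of_pos hs0', ENNReal.ofReal_coe_nnreal] at this
    exact this.not_gt (ENNReal.lt_inv_iff_lt_inv.1 hs)
  have := h (-Real.log s) (by rwa [Real.exp_neg, Real.exp_log hs0'])
  rwa [mul_neg, neg_neg, ← Real.log_pow, Real.exp_log (by positivity),
    ENNReal.ofReal_pow hs0'.le, ENNReal.ofReal_coe_nnreal] at this

/-- Integrability of negative powers of a log-subharmonic function with small Riesz mass. -/
lemma LogSubharmonic.lintegral_inv_pow_lt_top {f : ℂ → ℝ} (hf : LogSubharmonic f)
    {R ρ₁ ρ₂ B κ δ₀ : ℝ} {k : ℕ} (hk : k ≠ 0) (h1 : 0 < ρ₁)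
    (h12 : ρ₁ < ρ₂) (h2 : ρ₂ < R) (hB0 : 0 ≤ B)
    (hB : ∀ c ≤ 0, ∀ z, ‖z‖ ≤ R → truncLog f c z ≤ B) (hδ₀ : 0 < δ₀) (hκ : 0 < κ)
    (hκk : k * κ < 2)
    (hK : ∀ c ≤ 0, ∀ p, ‖p‖ < δ₀ → ∫⁻ q, truncPot f B c (p + q) ∂(discProb ρ₁) ≤
      ENNReal.ofReal (κ * Real.log (ρ₂ / ρ₁))) :
    ∫⁻ z in Metric.ball (0:ℂ) (ρ₁ / 4), (ENNReal.ofReal (f z))⁻¹ ^ k < ⊤ := by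
  obtain ⟨C, hC, ν, hν, hpot⟩ := hf.exists_potential h1 h12 h2 hB0 hB hδ₀ hκ.le hK
  obtain ⟨Q, hQ, hQle⟩ := lintegral_exp_posLog_le (half_pos h1) hκk (ρ₁ / 4)
  have hfin : ∀ n, IsFiniteMeasure (ν n) := fun n ↦ ⟨(hν n).trans_lt ENNReal.ofReal_lt_top⟩
  lift C to ℝ≥0 using hC
  have hk0 : (0:ℝ) < k := by positivity
  let F : ℂ × ℂ → ℝ≥0∞ := fun x ↦
    ENNReal.ofReal (Real.exp (k * κ * Real.posLog (ρ₁ / 2 / ‖x.1 - x.2‖)))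
  have hFm : Measurable F := by
    simp only [F, Real.posLog]
    fun_prop
  let U : ℕ → ℂ → ℝ≥0∞ := fun n z ↦ ENNReal.ofReal (Real.exp 1) +
    (ENNReal.ofReal κ)⁻¹ * ∫⁻ y, F (z, y) ∂(ν n)
  have hUm : ∀ n, Measurable (U n) := fun n ↦
    measurable_const.add (measurable_const.mul hFm.lintegral_prod_right')
  have hpt : ∀ z ∈ Metric.ball (0:ℂ) (ρ₁ / 4), (ENNReal.ofReal (f z))⁻¹ ^ k ≤
      ENNReal.ofReal (Real.exp (k * C)) * liminf (fun n ↦ U n z) atTop := by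
    intro z hz
    refine inv_pow_le_of_forall hk fun t ht ↦ ?_
    have h3 : ENNReal.ofReal (Real.exp (k * (-t - C))) ≤ liminf (fun n ↦ U n z) atTop := by
      refine le_liminf_of_le (by isBoundedDefault) ?_
      filter_upwards [hpot z (by simpa using hz) t ht] with n hn
      refine ofReal_exp_le_lintegral hκ hk0 (hν n) ?_ ?_
      · unfold Real.posLog; fun_prop
      · rw [ENNReal.ofReal_sub _ C.coe_nonneg, ENNReal.ofReal_coe_nnreal]
        exact tsub_le_iff_left.2 hn
    calc ENNReal.ofReal (Real.exp (-(k * t))) =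
        ENNReal.ofReal (Real.exp (k * C)) * ENNReal.ofReal (Real.exp (k * (-t - C))) := by
          rw [← ENNReal.ofReal_mul (Real.exp_pos _).le, ← Real.exp_add]
          ring_nf
      _ ≤ _ := by gcongr
  have hint : ∀ n, ∫⁻ z in Metric.ball (0:ℂ) (ρ₁ / 4), U n z ≤
      ENNReal.ofReal (Real.exp 1) * volume (Metric.ball (0:ℂ) (ρ₁ / 4)) + Q := by
    intro n
    rw [lintegral_add_left measurable_const, lintegral_const, Measure.restrict_apply_univ,
      lintegral_const_mul _ hFm.lintegral_prod_right', lintegral_lintegral_swap hFm.aemeasurable]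
    gcongr
    calc _ ≤ (ENNReal.ofReal κ)⁻¹ * ∫⁻ _, Q ∂(ν n) := by
          gcongr with y
          exact hQle y
      _ ≤ (ENNReal.ofReal κ)⁻¹ * (Q * ENNReal.ofReal κ) := by
          rw [lintegral_const]
          gcongr
          exact hν n
      _ = Q := by
          rw [mul_comm, mul_assoc, ENNReal.mul_inv_cancel (by simpa using hκ)
            ENNReal.ofReal_ne_top, mul_one]
  calc _ ≤ ∫⁻ z in Metric.ball (0:ℂ) (ρ₁ / 4),
        ENNReal.ofReal (Real.exp (k * C)) * liminf (fun n ↦ U n z) atTop :=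
        setLIntegral_mono' measurableSet_ball hpt
    _ = ENNReal.ofReal (Real.exp (k * C)) *
        ∫⁻ z in Metric.ball (0:ℂ) (ρ₁ / 4), liminf (fun n ↦ U n z) atTop :=
        lintegral_const_mul' _ _ ENNReal.ofReal_ne_top
    _ ≤ ENNReal.ofReal (Real.exp (k * C)) *
        (ENNReal.ofReal (Real.exp 1) * volume (Metric.ball (0:ℂ) (ρ₁ / 4)) + Q) := by
        gcongr
        refine (lintegral_liminf_le hUm).trans ?_
        exact liminf_le_of_le (by isBoundedDefault) fun b hb ↦ hb.exists.choose_spec.trans (hint _)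
    _ < ⊤ := by
        refine ENNReal.mul_lt_top ENNReal.ofReal_lt_top (ENNReal.add_lt_top.2
          ⟨ENNReal.mul_lt_top ENNReal.ofReal_lt_top measure_ball_lt_top, hQ.lt_top⟩)

/-- The ratio of the maximum of `log f` on the circle of radius `r` to `log r`. -/
def growthRatio (f : ℂ → ℝ) (r : ℝ) : ℝ :=
  (⨆ θ : ℝ, Real.log (f ((r : ℂ) * Complex.exp (θ * Complex.I)))) / Real.log r

namespace LogSubharmonic

variable {f : ℂ → ℝ}

lemma norm_ofReal_mul_exp {r : ℝ} (hr : 0 ≤ r) (θ : ℝ) :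
    ‖(r : ℂ) * Complex.exp (θ * Complex.I)‖ = r := by
  rw [norm_mul, Complex.norm_exp_ofReal_mul_I, mul_one, Complex.norm_real, Real.norm_of_nonneg hr]

lemma exists_log_circle_le (hf : LogSubharmonic f) : ∃ B, 0 ≤ B ∧ ∀ r : ℝ, 0 ≤ r → r ≤ 1 → ∀ θ : ℝ,
    Real.log (f ((r : ℂ) * Complex.exp (θ * Complex.I))) ≤ B := by
  obtain ⟨B, hB0, hB⟩ := hf.exists_le_exp 1
  refine ⟨B, hB0, fun r hr hr1 θ ↦ ?_⟩
  set z := (r : ℂ) * Complex.exp (θ * Complex.I) with hz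
  rcases (hf.nonneg z).eq_or_lt with h | h
  · rwa [← h, Real.log_zero]
  · exact (Real.log_le_iff_le_exp h).2 (hB z (by rwa [hz, norm_ofReal_mul_exp hr]))

lemma bddAbove_log_circle (hf : LogSubharmonic f) {r : ℝ} (hr : 0 ≤ r) (hr1 : r ≤ 1) :
    BddAbove (Set.range fun θ : ℝ ↦ Real.log (f ((r : ℂ) * Complex.exp (θ * Complex.I)))) := by
  obtain ⟨B, -, hB⟩ := hf.exists_log_circle_le
  exact ⟨B, by rintro _ ⟨θ, rfl⟩; exact hB r hr hr1 θ⟩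

lemma log_le_growthRatio_mul (hf : LogSubharmonic f) {r : ℝ} (hr : 0 < r) (hr1 : r < 1) {z : ℂ}
    (hz : ‖z‖ = r) : Real.log (f z) ≤ growthRatio f r * Real.log r := by
  rw [growthRatio, div_mul_cancel₀ _ (Real.log_neg hr hr1).ne]
  have := le_ciSup (hf.bddAbove_log_circle hr.le hr1.le) z.arg
  rwa [← hz, Complex.norm_mul_exp_arg_mul_I, hz] at this

lemma eventually_mem_Ioo {ε : ℝ} (hε : 0 < ε) : ∀ᶠ r in 𝓝[>] (0:ℝ), r ∈ Set.Ioo 0 ε :=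
  Ioo_mem_nhdsGT hε

lemma isBoundedUnder_le_growthRatio (hf : LogSubharmonic f) :
    IsBoundedUnder (· ≤ ·) (𝓝[>] 0) (growthRatio f) := by
  obtain ⟨C, hC⟩ := hf.exists_exp_lt
  refine isBoundedUnder_of_eventually_le (a := C) ?_
  filter_upwards [hC, eventually_mem_Ioo one_pos] with r hr hr1
  obtain ⟨z, hz, hlt⟩ := hr
  have h1 := hf.log_le_growthRatio_mul hr1.1 hr1.2 hz
  have h2 := (Real.lt_log_iff_exp_lt ((Real.exp_pos _).trans hlt)).2 hlt
  exact (mul_le_mul_right_of_neg (Real.log_neg hr1.1 hr1.2)).1 (h2.le.trans h1)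

lemma isCoboundedUnder_le_growthRatio (hf : LogSubharmonic f) :
    IsCoboundedUnder (· ≤ ·) (𝓝[>] 0) (growthRatio f) := by
  obtain ⟨B, hB0, hB⟩ := hf.exists_log_circle_le
  refine IsBoundedUnder.isCoboundedUnder_le (isBoundedUnder_of_eventually_ge (a := -1) ?_)
  filter_upwards [eventually_mem_Ioo one_pos,
    Real.tendsto_log_nhdsGT_zero.eventually (eventually_le_atBot (-B))] with r hr hr2
  rw [growthRatio, le_div_iff_of_neg (Real.log_neg hr.1 hr.2)]
  exact (ciSup_le (hB r hr.1.le hr.2.le)).trans (by linarith)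

lemma le_of_not_limsup_lt (hf : LogSubharmonic f) {s₀ : ℝ} (hs₀ : 0 < s₀)
    (h : ¬ limsup (growthRatio f) (𝓝[>] 0) < s₀) :
    ∃ B, ∀ z, z ≠ 0 → ‖z‖ < 1 → f z ≤ Real.exp (s₀ * Real.log ‖z‖ + B) := by
  refine hf.le_of_frequently hs₀ fun s hs hss ↦ ?_
  have := frequently_lt_of_lt_limsup hf.isCoboundedUnder_le_growthRatio (hss.trans_le (not_lt.1 h))
  refine (this.and_eventually (eventually_mem_Ioo one_pos)).mono fun r hr z hz ↦ ?_
  rcases (hf.nonneg z).eq_or_lt with h0 | h0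
  · rw [← h0]; positivity
  · rw [← Real.log_le_iff_le_exp h0]
    refine (hf.log_le_growthRatio_mul hr.2.1 hr.2.2 hz).trans ?_
    exact mul_le_mul_of_nonpos_right hr.1.le (Real.log_neg hr.2.1 hr.2.2).le

lemma exists_lintegral_inv_pow_lt_top (hf : LogSubharmonic f) {k : ℕ} (hk : k ≠ 0)
    (h : limsup (growthRatio f) (𝓝[>] 0) < 2 / k) :
    ∃ ε > 0, ∫⁻ z in Metric.ball (0:ℂ) ε, (ENNReal.ofReal (f z))⁻¹ ^ k < ⊤ := by
  have hk0 : (0:ℝ) < k := by positivity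
  obtain ⟨s, hs, hs2⟩ := exists_between (max_lt h (by positivity : (0:ℝ) < 2 / k))
  have hs0 : 0 < s := (le_max_right _ _).trans_lt hs
  obtain ⟨κ, hκs, hκ2⟩ := exists_between hs2
  have hev : ∀ᶠ r in 𝓝[>] 0, growthRatio f r < s :=
    eventually_lt_of_limsup_lt ((le_max_left _ _).trans_lt hs) hf.isBoundedUnder_le_growthRatio
  obtain ⟨B, hB0, hB⟩ := exists_truncLog_le hf.usc (isCompact_closedBall (0:ℂ) 2)
  have hB : ∀ c ≤ 0, ∀ z, ‖z‖ ≤ 2 → truncLog f c z ≤ B :=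
    fun c hc z hz ↦ hB c hc z (by simpa using hz)
  obtain ⟨M, hM0, hM⟩ : ∃ M : ℝ, 0 < M ∧ ((M + 2) / M) ^ 2 * s < κ := by
    have hlim : Tendsto (fun M : ℝ ↦ (1 + 2 / M) ^ 2 * s) atTop (𝓝 ((1 + 0) ^ 2 * s)) :=
      (((tendsto_const_nhds.div_atTop tendsto_id).const_add 1).pow 2).mul_const s
    obtain ⟨M, h1, h2⟩ := ((hlim.eventually_lt_const (by simpa using hκs)).and
      (eventually_gt_atTop 0)).exists
    refine ⟨M, h2, ?_⟩
    rwa [add_div, div_self h2.ne']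
  set q := ((M + 2) / M) ^ 2 with hq
  have hsmall : ∀ᶠ r in 𝓝[>] (0:ℝ), Real.log r ≤ -((q * B + κ * Real.log M) / (κ - q * s)) :=
    Real.tendsto_log_nhdsGT_zero.eventually (eventually_le_atBot _)
  obtain ⟨ε, hε, hsub⟩ := mem_nhdsGT_iff_exists_Ioo_subset.1 (hev.and (hsmall.and
    ((eventually_mem_Ioo one_pos).and (eventually_mem_Ioo (inv_pos.2 (by linarith : 0 < M + 3))))))
  obtain ⟨r, hr0, hrε, hpos⟩ := hf.exists_circle_pos hε
  obtain ⟨hg, hlog, hr1, hr3⟩ := hsub ⟨hr0, hrε⟩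
  have hr3' : (M + 3) * r < 1 := by
    have := mul_lt_mul_of_pos_left hr3.2 (by linarith : 0 < M + 3)
    rwa [mul_inv_cancel₀ (by linarith)] at this
  have hl : Real.log r < 0 := Real.log_neg hr0 hr1.2
  obtain ⟨a, ha, hfa⟩ : ∃ a, ‖a‖ = r ∧ s * Real.log r < Real.log (f a) := by
    have hlt : s * Real.log r <
        ⨆ θ : ℝ, Real.log (f ((r : ℂ) * Complex.exp (θ * Complex.I))) := by
      rwa [growthRatio, div_lt_iff_of_neg hl] at hg
    obtain ⟨θ, hθ⟩ := exists_lt_of_lt_ciSup hlt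
    exact ⟨_, norm_ofReal_mul_exp hr0.le θ, hθ⟩
  have hMr : 0 < M * r := by positivity
  refine ⟨M * r / 4, by positivity, hf.lintegral_inv_pow_lt_top (κ := κ) hk hMr
    (by nlinarith : M * r < 1) one_lt_two hB0 hB hr0 (hs0.trans hκs) ?_ fun c hc p hp ↦ ?_⟩
  · rwa [lt_div_iff₀ hk0, mul_comm] at hκ2
  · refine (hf.truncPot_disc_le (hB c hc) hMr (r := (M + 2) * r) (by positivity) (hpos a ha)
      (by rw [ha]; linarith) ?_).trans (ENNReal.ofReal_le_ofReal ?_)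
    · linarith [norm_sub_le p a]
    · have e1 : (M + 2) * r / (M * r) = (M + 2) / M := by field_simp
      rw [e1, ← hq, Real.log_div one_ne_zero hMr.ne', Real.log_one,
        Real.log_mul hM0.ne' hr0.ne']
      have h5 : 0 < κ - q * s := by linarith
      have h6 : (q * B + κ * Real.log M) / (κ - q * s) ≤ -Real.log r := by linarith
      rw [div_le_iff₀ h5] at h6
      have h7 : q * (s * Real.log r) ≤ q * Real.log (f a) := by gcongr
      linarith

end LogSubharmonic

lemma exists_addHaar_eq_smul {E : Type*} [NormedAddCommGroup E] [NormedSpace ℝ E]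
    [FiniteDimensional ℝ E] [MeasurableSpace E] [BorelSpace E] (μ ν : Measure E)
    [μ.IsAddHaarMeasure] [ν.IsAddHaarMeasure] : ∃ c : ℝ≥0∞, c ≠ 0 ∧ c ≠ ⊤ ∧ μ = c • ν :=
  ⟨Measure.addHaarScalarFactor μ ν,
    ENNReal.coe_ne_zero.2 (Measure.addHaarScalarFactor_pos_of_isAddHaarMeasure μ ν).ne',
    ENNReal.coe_ne_top, Measure.isAddLeftInvariant_eq_smul μ ν⟩

lemma lintegral_complex_mul_left {t : ℂ} (ht : t ≠ 0) {g : ℂ → ℝ≥0∞} (hg : Measurable g) :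
    ∫⁻ ζ, g ζ = ‖t‖ₑ ^ 2 * ∫⁻ ζ, g (t * ζ) := by
  let L : ℂ ≃L[ℂ] ℂ := ContinuousLinearEquiv.unitsEquivAut ℂ (Units.mk0 t ht)
  have hL : ∀ ζ, L ζ = t * ζ := fun ζ ↦ by simp [L, mul_comm]
  obtain ⟨c, -, hc, hcL⟩ := exists_addHaar_eq_smul
    (volume : Measure ℂ) (volume.map L)
  have h1 := congrArg (fun μ ↦ μ (Metric.ball (0:ℂ) ‖t‖)) hcL
  have hpre : L ⁻¹' Metric.ball (0:ℂ) ‖t‖ = Metric.ball 0 1 := by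
    ext ζ
    simp [hL, norm_pos_iff.2 ht]
  have hc' : c = ‖t‖ₑ ^ 2 := by
    have hpi : (NNReal.pi : ℝ≥0∞) ≠ 0 := by simp [NNReal.pi_ne_zero]
    simp only [Measure.smul_apply, smul_eq_mul] at h1
    rw [Measure.map_apply L.continuous.measurable measurableSet_ball, hpre, Complex.volume_ball,
      Complex.volume_ball] at h1
    simp only [ENNReal.ofReal_one, one_pow, one_mul] at h1
    rw [← ofReal_norm]
    exact ((ENNReal.mul_left_inj hpi ENNReal.coe_ne_top).1 h1).symm
  calc ∫⁻ ζ, g ζ = ∫⁻ ζ, g ζ ∂(c • volume.map L) := by rw [← hcL]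
    _ = _ := by
      rw [lintegral_smul_measure, lintegral_map hg L.continuous.measurable, hc', smul_eq_mul]
      simp only [hL]

/-- Integration over `ℂ²` in the coordinates `z = t • T (ζ, 1)`. -/
lemma exists_lintegral_chart (T : (ℂ × ℂ) ≃L[ℂ] (Fin 2 → ℂ)) : ∃ c : ℝ≥0∞, c ≠ 0 ∧ c ≠ ⊤ ∧
    ∀ G : (Fin 2 → ℂ) → ℝ≥0∞, Measurable G →
      ∫⁻ z, G z = c * ∫⁻ ζ : ℂ, ∫⁻ t : ℂ, ‖t‖ₑ ^ 2 * G (t • T (ζ, 1)) := by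
  have : Measure.IsAddHaarMeasure (((volume : Measure ℂ).prod volume).map T) :=
    ContinuousLinearEquiv.isAddHaarMeasure_map T (volume.prod volume)
  obtain ⟨c, hc0, hc, hcT⟩ := exists_addHaar_eq_smul
    (volume : Measure (Fin 2 → ℂ)) (((volume : Measure ℂ).prod volume).map T)
  refine ⟨c, hc0, hc, fun G hG ↦ ?_⟩
  have hT : ∀ ζ t : ℂ, t • T (ζ, 1) = T (t * ζ, t) := fun ζ t ↦ by
    rw [← map_smul]; simp
  have hTm : Measurable T := T.continuous.measurable
  calc ∫⁻ z, G z = c * ∫⁻ p : ℂ × ℂ, G (T p) ∂(volume.prod volume) := by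
        conv_lhs => rw [hcT]
        rw [lintegral_smul_measure, lintegral_map hG hTm, smul_eq_mul]
    _ = c * ∫⁻ t : ℂ, ∫⁻ s : ℂ, G (T (s, t)) := by
        rw [lintegral_prod_symm' (fun p ↦ G (T p)) (hG.comp hTm)]
    _ = c * ∫⁻ t : ℂ, ∫⁻ ζ : ℂ, ‖t‖ₑ ^ 2 * G (t • T (ζ, 1)) := by
        congr 1
        refine lintegral_congr_ae ?_
        filter_upwards [compl_mem_ae_iff.2 (measure_singleton (0:ℂ))] with t ht
        rw [lintegral_complex_mul_left (t := t) ht (by fun_prop),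
          lintegral_const_mul _ (by simp only [hT]; fun_prop)]
        simp only [hT]
    _ = _ := by
        rw [lintegral_lintegral_swap]
        simp only [hT]
        fun_prop

/-- Linear coordinates of `ℂ²` with respect to the basis `b, a`. -/
lemma exists_chart {a b : Fin 2 → ℂ} (hab : ∀ z, ∃ s t : ℂ, z = s • b + t • a) :
    ∃ T : (ℂ × ℂ) ≃L[ℂ] (Fin 2 → ℂ), ∀ p, T p = p.1 • b + p.2 • a := by
  let F : (ℂ × ℂ) →ₗ[ℂ] (Fin 2 → ℂ) :=
    (LinearMap.toSpanSingleton ℂ _ b).coprod (LinearMap.toSpanSingleton ℂ _ a)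
  have hs : Function.Surjective F := fun z ↦ by
    obtain ⟨s, t, h⟩ := hab z
    exact ⟨(s, t), by simp [F, h]⟩
  have hi : Function.Injective F :=
    (LinearMap.injective_iff_surjective_of_finrank_eq_finrank (by simp)).2 hs
  exact ⟨(LinearEquiv.ofBijective F ⟨hi, hs⟩).toContinuousLinearEquiv,
    fun p ↦ by
      change F p = _
      simp [F]⟩

lemma exists_basis {v : Fin 2 → ℂ} (hv : v ≠ 0) (h : (Fin 2 → ℂ) → ℝ) :
    ∃ b : Fin 2 → ℂ, (∀ z, ∃ s t : ℂ, z = s • b + t • v) ∧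
      lelong h v = limsup (growthRatio fun ζ ↦ h (v + ζ • b)) (𝓝[>] 0) := by
  by_cases h1 : v 1 = 0
  · have h0 : v 0 ≠ 0 := fun h0 ↦ hv (by ext i; fin_cases i <;> simp [h0, h1])
    refine ⟨![0, 1], fun z ↦ ⟨z 1, z 0 / v 0, ?_⟩, ?_⟩
    · ext i; fin_cases i <;> simp [h0, h1]
    · have e : ∀ ζ : ℂ, v + ζ • ![0, 1] = ![v 0, ζ] := fun ζ ↦ by
        ext i; fin_cases i <;> simp [h1]
      simp only [lelong, h1, e]
      simp
      rfl
  · refine ⟨![1, 0], fun z ↦ ⟨z 0 - z 1 / v 1 * v 0, z 1 / v 1, ?_⟩, ?_⟩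
    · ext i; fin_cases i <;> simp [h1]
    · have e : ∀ ζ : ℂ, v + ζ • ![1, 0] = ![v 0 + ζ, v 1] := fun ζ ↦ by
        ext i; fin_cases i <;> simp
      simp only [lelong, e]
      simp [h1]
      rfl

lemma memL2h_coord_iff {D : Set (Fin 2 → ℂ)} :
    (MemL2h D (fun z ↦ z 0) ∧ MemL2h D (fun z ↦ z 1)) ↔ ∫⁻ z in D, ‖z‖ₑ ^ 2 < ⊤ := by
  have hd : ∀ i : Fin 2, DifferentiableOn ℂ (fun z : Fin 2 → ℂ ↦ z i) D :=
    fun i ↦ by fun_prop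
  have hle : ∀ (z : Fin 2 → ℂ) (i), ‖z i‖ₑ ≤ ‖z‖ₑ := fun z i ↦ by
    rw [enorm_le_iff_norm_le]; exact norm_le_pi_norm z i
  have hsum : ∀ z : Fin 2 → ℂ, ‖z‖ₑ ^ 2 ≤ ‖z 0‖ₑ ^ 2 + ‖z 1‖ₑ ^ 2 := fun z ↦ by
    obtain ⟨i, hi⟩ : ∃ i, ‖z‖ ≤ ‖z i‖ := by
      obtain ⟨i, -, hi⟩ := Finset.exists_mem_eq_sup (Finset.univ (α := Fin 2)) (by simp)
        fun i ↦ ‖z i‖₊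
      refine ⟨i, ?_⟩
      rw [Pi.norm_def, hi]; rfl
    have hi' : ‖z‖ₑ ≤ ‖z i‖ₑ := enorm_le_iff_norm_le.2 hi
    fin_cases i
    · exact (pow_le_pow_left' hi' 2).trans le_self_add
    · exact (pow_le_pow_left' hi' 2).trans le_add_self
  constructor
  · rintro ⟨⟨-, h0⟩, -, h1⟩
    refine (lintegral_mono hsum).trans_lt ?_
    rw [lintegral_add_left (by fun_prop)]
    exact ENNReal.add_lt_top.2 ⟨h0, h1⟩
  · intro H
    exact ⟨⟨hd 0, (lintegral_mono fun z ↦ pow_le_pow_left' (hle z 0) 2).trans_lt H⟩,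
      hd 1, (lintegral_mono fun z ↦ pow_le_pow_left' (hle z 1) 2).trans_lt H⟩

lemma setLIntegral_norm_pow_four_le {x : ℝ} (hx : 0 ≤ x) :
    ∫⁻ t in {t : ℂ | ‖t‖ * x < 1}, ‖t‖ₑ ^ 4 ≤ NNReal.pi * (ENNReal.ofReal x)⁻¹ ^ 6 := by
  rcases hx.eq_or_lt with rfl | hx
  · simp [ENNReal.mul_top, NNReal.pi_ne_zero]
  have hset : {t : ℂ | ‖t‖ * x < 1} = Metric.ball 0 x⁻¹ := by
    ext t
    simp [← lt_div_iff₀ hx]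
  rw [hset, ← ENNReal.ofReal_inv_of_pos hx]
  calc ∫⁻ t in Metric.ball (0:ℂ) x⁻¹, ‖t‖ₑ ^ 4
      ≤ ∫⁻ _ in Metric.ball (0:ℂ) x⁻¹, ENNReal.ofReal x⁻¹ ^ 4 := by
        refine setLIntegral_mono measurable_const fun t ht ↦ ?_
        rw [← ofReal_norm]
        exact pow_le_pow_left' (ENNReal.ofReal_le_ofReal (mem_ball_zero_iff.1 ht).le) 4
    _ = _ := by
        rw [setLIntegral_const, Complex.volume_ball]
        ring

lemma le_setLIntegral_norm_pow_four {x ρ : ℝ} (hρ : 0 < ρ) (hx : x * ρ ≤ 1) :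
    ENNReal.ofReal (ρ ^ 6 / 256) * NNReal.pi ≤ ∫⁻ t in {t : ℂ | ‖t‖ * x < 1}, ‖t‖ₑ ^ 4 := by
  set p : ℂ := ((3 * ρ / 4 : ℝ) : ℂ)
  have hp : ‖p‖ = 3 * ρ / 4 := by
    rw [Complex.norm_real, Real.norm_of_nonneg (by positivity)]
  have hb : ∀ t ∈ Metric.ball p (ρ / 4), ρ / 2 ≤ ‖t‖ ∧ ‖t‖ < ρ := fun t ht ↦ by
    rw [mem_ball_iff_norm] at ht
    have h1 := norm_sub_norm_le p t
    have h2 := norm_sub_norm_le t p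
    rw [norm_sub_rev] at h1
    constructor <;> linarith
  have hsub : Metric.ball p (ρ / 4) ⊆ {t : ℂ | ‖t‖ * x < 1} := fun t ht ↦ by
    obtain ⟨h1, h2⟩ := hb t ht
    rcases le_or_gt x 0 with h | h
    · have : ‖t‖ * x ≤ 0 := mul_nonpos_of_nonneg_of_nonpos (norm_nonneg t) h
      exact this.trans_lt one_pos
    · calc ‖t‖ * x < ρ * x := by gcongr
        _ ≤ 1 := by linarith
  calc ENNReal.ofReal (ρ ^ 6 / 256) * NNReal.pi
      = ∫⁻ _ in Metric.ball p (ρ / 4), ENNReal.ofReal (ρ / 2) ^ 4 := by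
        rw [setLIntegral_const, Complex.volume_ball, ← ENNReal.ofReal_pow (by positivity),
          ← ENNReal.ofReal_pow (by positivity), ← mul_assoc, ← ENNReal.ofReal_mul (by positivity)]
        congr 2
        ring
    _ ≤ ∫⁻ t in Metric.ball p (ρ / 4), ‖t‖ₑ ^ 4 := by
        refine setLIntegral_mono (by fun_prop) fun t ht ↦ ?_
        rw [← ofReal_norm]
        exact pow_le_pow_left' (ENNReal.ofReal_le_ofReal (hb t ht).1) 4
    _ ≤ _ := lintegral_mono_set hsub

section

variable {h : (Fin 2 → ℂ) → ℝ}

lemma isOpen_balanced (husc : UpperSemicontinuous h) : IsOpen {z | h z < 1} :=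
  husc.isOpen_preimage 1

lemma setLIntegral_cone_lt_top (hpos : ∀ z, 0 ≤ h z) (husc : UpperSemicontinuous h)
    (hhom : AbsHomog h) (T : (ℂ × ℂ) ≃L[ℂ] (Fin 2 → ℂ)) {ε : ℝ} (hε : 0 < ε)
    (hint : ∫⁻ ζ in Metric.ball (0:ℂ) ε, (ENNReal.ofReal (h (T (ζ, 1))))⁻¹ ^ 6 < ⊤) :
    ∫⁻ z in {z | h z < 1} ∩ {z | ‖(T.symm z).1‖ < ε * ‖(T.symm z).2‖}, ‖z‖ₑ ^ 2 < ⊤ := by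
  set S := {z | h z < 1} ∩ {z | ‖(T.symm z).1‖ < ε * ‖(T.symm z).2‖}
  have hS : MeasurableSet S := ((isOpen_balanced husc).inter
    (isOpen_lt (by fun_prop) (by fun_prop))).measurableSet
  obtain ⟨c, -, hc, hcT⟩ := exists_lintegral_chart T
  set M : ℝ≥0∞ := ENNReal.ofReal (‖(T : (ℂ × ℂ) →L[ℂ] (Fin 2 → ℂ))‖ * (ε + 1))
  have key : ∀ ζ t : ℂ, ‖t‖ₑ ^ 2 * S.indicator (fun z ↦ ‖z‖ₑ ^ 2) (t • T (ζ, 1)) ≤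
      (Metric.ball (0:ℂ) ε).indicator (fun ζ ↦ M ^ 2 *
        {t : ℂ | ‖t‖ * h (T (ζ, 1)) < 1}.indicator (fun t ↦ ‖t‖ₑ ^ 4) t) ζ := fun ζ t ↦ by
    by_cases hz : t • T (ζ, 1) ∈ S
    · have ⟨h1, h2⟩ := hz
      have hh : ‖t‖ * h (T (ζ, 1)) < 1 := by
        rw [← hhom]; exact h1
      simp only [Set.mem_ofPred_eq, map_smul, ContinuousLinearEquiv.symm_apply_apply,
        Prod.smul_fst, Prod.smul_snd, norm_smul, norm_one, mul_one] at h2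
      have hζ : ‖ζ‖ < ε := by
        by_contra! hcon
        nlinarith [norm_nonneg t]
      rw [Set.indicator_of_mem hz,
        Set.indicator_of_mem (mem_ball_zero_iff.2 hζ), Set.indicator_of_mem (by exact hh)]
      have hT : ‖T (ζ, 1)‖ₑ ≤ M := by
        rw [← ofReal_norm]
        refine ENNReal.ofReal_le_ofReal ?_
        refine ((T : (ℂ × ℂ) →L[ℂ] (Fin 2 → ℂ)).le_opNorm (ζ, 1)).trans ?_
        gcongr
        rw [Prod.norm_mk, norm_one]
        exact max_le (by linarith) (by linarith)
      calc ‖t‖ₑ ^ 2 * ‖t • T (ζ, 1)‖ₑ ^ 2 = ‖T (ζ, 1)‖ₑ ^ 2 * ‖t‖ₑ ^ 4 := by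
            rw [enorm_smul]; ring
        _ ≤ _ := by gcongr
    · rw [Set.indicator_of_notMem hz, mul_zero]
      exact zero_le
  rw [← lintegral_indicator hS,
    hcT _ ((by fun_prop : Measurable fun z : Fin 2 → ℂ ↦ ‖z‖ₑ ^ 2).indicator hS)]
  refine ENNReal.mul_lt_top hc.lt_top ?_
  calc ∫⁻ ζ : ℂ, ∫⁻ t : ℂ, ‖t‖ₑ ^ 2 * S.indicator (fun z ↦ ‖z‖ₑ ^ 2) (t • T (ζ, 1))
      ≤ ∫⁻ ζ : ℂ, ∫⁻ t : ℂ, (Metric.ball (0:ℂ) ε).indicator (fun ζ ↦ M ^ 2 *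
        {t : ℂ | ‖t‖ * h (T (ζ, 1)) < 1}.indicator (fun t ↦ ‖t‖ₑ ^ 4) t) ζ :=
        lintegral_mono fun ζ ↦ lintegral_mono fun t ↦ key ζ t
    _ ≤ ∫⁻ ζ : ℂ, (Metric.ball (0:ℂ) ε).indicator (fun ζ ↦
        M ^ 2 * (NNReal.pi * (ENNReal.ofReal (h (T (ζ, 1))))⁻¹ ^ 6)) ζ := by
        refine lintegral_mono fun ζ ↦ ?_
        by_cases hζ : ζ ∈ Metric.ball (0:ℂ) ε
        · simp only [Set.indicator_of_mem hζ]
          have hm : MeasurableSet {t : ℂ | ‖t‖ * h (T (ζ, 1)) < 1} :=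
            measurableSet_lt (by fun_prop) (by fun_prop)
          rw [lintegral_const_mul _ (by fun_prop (disch := exact hm)), lintegral_indicator hm]
          gcongr
          exact setLIntegral_norm_pow_four_le (hpos _)
        · simp [Set.indicator_of_notMem hζ]
    _ = M ^ 2 * (NNReal.pi * ∫⁻ ζ in Metric.ball (0:ℂ) ε,
          (ENNReal.ofReal (h (T (ζ, 1))))⁻¹ ^ 6) := by
        rw [lintegral_indicator measurableSet_ball,
          lintegral_const_mul' _ _ (ENNReal.pow_ne_top ENNReal.ofReal_ne_top),
          lintegral_const_mul' _ _ (by simp)]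
    _ < ⊤ := ENNReal.mul_lt_top (ENNReal.pow_lt_top ENNReal.ofReal_lt_top)
        (ENNReal.mul_lt_top (by simp) hint)

lemma setLIntegral_balanced_eq_top (husc : UpperSemicontinuous h)
    (hhom : AbsHomog h) (T : (ℂ × ℂ) ≃L[ℂ] (Fin 2 → ℂ)) {B : ℝ}
    (hB : ∀ ζ : ℂ, ζ ≠ 0 → ‖ζ‖ < 1 → h (T (ζ, 1)) ≤ Real.exp (1 / 3 * Real.log ‖ζ‖ + B)) :
    ∫⁻ z in {z | h z < 1}, ‖z‖ₑ ^ 2 = ⊤ := by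
  by_contra hfin
  set S := {z | h z < 1}
  have hS : MeasurableSet S := (isOpen_balanced husc).measurableSet
  obtain ⟨c, hc0, -, hcT⟩ := exists_lintegral_chart T
  rw [← lintegral_indicator hS,
    hcT _ ((by fun_prop : Measurable fun z : Fin 2 → ℂ ↦ ‖z‖ₑ ^ 2).indicator hS)] at hfin
  set N : ℝ≥0∞ := ‖(T.symm : (Fin 2 → ℂ) →L[ℂ] (ℂ × ℂ))‖ₑ
  have key : ∀ ζ t : ℂ, {t : ℂ | ‖t‖ * h (T (ζ, 1)) < 1}.indicator (fun t ↦ ‖t‖ₑ ^ 4) t ≤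
      N ^ 2 * (‖t‖ₑ ^ 2 * S.indicator (fun z ↦ ‖z‖ₑ ^ 2) (t • T (ζ, 1))) := fun ζ t ↦ by
    by_cases ht : ‖t‖ * h (T (ζ, 1)) < 1
    · rw [Set.indicator_of_mem (by exact ht), Set.indicator_of_mem (by
        change h _ < 1
        rwa [hhom])]
      have hle : ‖t‖ₑ ≤ N * ‖t • T (ζ, 1)‖ₑ := by
        have h1 := (T.symm : (Fin 2 → ℂ) →L[ℂ] (ℂ × ℂ)).le_opENorm (t • T (ζ, 1))
        refine le_trans ?_ h1
        rw [enorm_le_iff_norm_le]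
        simp [Prod.norm_def]
      calc ‖t‖ₑ ^ 4 = ‖t‖ₑ ^ 2 * ‖t‖ₑ ^ 2 := by ring
        _ ≤ (N * ‖t • T (ζ, 1)‖ₑ) ^ 2 * ‖t‖ₑ ^ 2 := by gcongr
        _ = _ := by ring
    · rw [Set.indicator_of_notMem (by exact ht)]
      exact zero_le
  set I := ∫⁻ ζ : ℂ, ∫⁻ t : ℂ, ‖t‖ₑ ^ 2 * S.indicator (fun z ↦ ‖z‖ₑ ^ 2) (t • T (ζ, 1))
  have hI : I ≠ ⊤ := fun hI ↦ hfin (by rw [hI, ENNReal.mul_top hc0])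
  have hlow : ENNReal.ofReal (Real.exp (-6 * B) / 256) * NNReal.pi *
      ∫⁻ ζ in Metric.ball (0:ℂ) 1, ENNReal.ofReal (‖ζ‖ ^ (-2 : ℝ)) ≤ N ^ 2 * I := by
    rw [← lintegral_const_mul _ (by fun_prop), ← lintegral_indicator measurableSet_ball,
      ← lintegral_const_mul' _ _ (by simp [N])]
    refine lintegral_mono_ae ?_
    filter_upwards [compl_mem_ae_iff.2 (measure_singleton (0:ℂ))] with ζ hζ0
    by_cases hζ : ζ ∈ Metric.ball (0:ℂ) 1
    · rw [Set.indicator_of_mem hζ, ← lintegral_const_mul' _ _ (by simp [N])]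
      have hm : MeasurableSet {t : ℂ | ‖t‖ * h (T (ζ, 1)) < 1} :=
        measurableSet_lt (by fun_prop) (by fun_prop)
      have hn : 0 < ‖ζ‖ := norm_pos_iff.2 hζ0
      set u := 1 / 3 * Real.log ‖ζ‖ + B with hu
      have hx : h (T (ζ, 1)) * Real.exp (-u) ≤ 1 := by
        calc _ ≤ Real.exp u * Real.exp (-u) := by
              gcongr
              exact hB ζ hζ0 (mem_ball_zero_iff.1 hζ)
          _ = 1 := by rw [← Real.exp_add]; simp
      have hρ : Real.exp (-u) ^ 6 / 256 = Real.exp (-6 * B) / 256 * ‖ζ‖ ^ (-2 : ℝ) := by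
        rw [Real.rpow_def_of_pos hn, div_mul_eq_mul_div, ← Real.exp_add, ← Real.exp_nat_mul]
        congr 2
        rw [hu]; push_cast; ring
      calc _ = ENNReal.ofReal (Real.exp (-u) ^ 6 / 256) * NNReal.pi := by
            rw [hρ, ENNReal.ofReal_mul (by positivity)]
            ring
        _ ≤ _ := le_setLIntegral_norm_pow_four (Real.exp_pos _) hx
        _ = _ := (lintegral_indicator hm _).symm
        _ ≤ _ := lintegral_mono fun t ↦ key ζ t
    · rw [Set.indicator_of_notMem hζ]
      exact zero_le
  have htop : ∫⁻ ζ in Metric.ball (0:ℂ) 1, ENNReal.ofReal (‖ζ‖ ^ (-2 : ℝ)) = ⊤ := by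
    by_contra hne
    have := (lintegral_ball_norm_rpow_lt_top_iff (volume : Measure ℂ) one_pos (-2)).1
      (lt_top_iff_ne_top.2 hne)
    simp [Complex.finrank_real_complex] at this
  rw [htop, ENNReal.mul_top] at hlow
  · exact ENNReal.mul_ne_top (by simp [N]) hI (top_le_iff.1 hlow)
  · simp [NNReal.pi_ne_zero, Real.exp_pos]

/-- The second moment of `D` is finite as soon as every direction has an open conical neighbourhood
in which it is finite. -/
lemma setLIntegral_lt_top_of_cones {D : Set (Fin 2 → ℂ)}
    (H : ∀ v : Fin 2 → ℂ, v ≠ 0 → ∃ K : Set (Fin 2 → ℂ), IsOpen K ∧ v ∈ K ∧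
      (∀ (r : ℝ) (z), 0 < r → r • z ∈ K → z ∈ K) ∧ ∫⁻ z in D ∩ K, ‖z‖ₑ ^ 2 < ⊤) :
    ∫⁻ z in D, ‖z‖ₑ ^ 2 < ⊤ := by
  choose! K hKo hKv hKs hKi using H
  obtain ⟨s, hs, hcov⟩ := (isCompact_sphere (0 : Fin 2 → ℂ) 1).elim_nhds_subcover K fun v hv ↦
    (hKo v (ne_zero_of_mem_unit_sphere ⟨v, hv⟩)).mem_nhds
      (hKv v (ne_zero_of_mem_unit_sphere ⟨v, hv⟩))
  have hD : D ⊆ {0} ∪ ⋃ v : s, D ∩ K v := fun z hz ↦ by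
    by_cases h0 : z = 0
    · exact Or.inl h0
    · right
      have hn : 0 < ‖z‖ := norm_pos_iff.2 h0
      have hmem : ‖z‖⁻¹ • z ∈ Metric.sphere (0 : Fin 2 → ℂ) 1 := by
        simp [norm_smul, hn.ne']
      obtain ⟨v, hv, hzv⟩ := Set.mem_iUnion₂.1 (hcov hmem)
      exact Set.mem_iUnion.2 ⟨⟨v, hv⟩, hz, hKs v (ne_zero_of_mem_unit_sphere ⟨v, hs v hv⟩) _ z
        (inv_pos.2 hn) hzv⟩
  refine (lintegral_mono_set hD).trans_lt ?_
  refine (lintegral_union_le _ _ _).trans_lt (ENNReal.add_lt_top.2 ⟨by simp, ?_⟩)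
  refine (lintegral_iUnion_le _ _).trans_lt ?_
  rw [tsum_fintype]
  exact ENNReal.sum_lt_top.2 fun ⟨v, hv⟩ _ ↦ hKi v (ne_zero_of_mem_unit_sphere ⟨v, hs v hv⟩)

end

/-- both coordinate functions belong to `L²_h(D_h)` iff
`ν(log h,[v]) < 1/3` for every `[v] ∈ ℙ¹`. -/
theorem statement_11 (h : (Fin 2 → ℂ) → ℝ)
    (hpos : ∀ z, 0 ≤ h z) (husc : UpperSemicontinuous h) (hhom : AbsHomog h)
    (hpsh : LogPSH h) (hne : ∃ z, h z ≠ 0) :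
    (MemL2h {z | h z < 1} (fun z => z 0) ∧ MemL2h {z | h z < 1} (fun z => z 1)) ↔
      ∀ v : Fin 2 → ℂ, v ≠ 0 → lelong h v < 1 / 3 := by
  rw [memL2h_coord_iff]
  constructor
  · intro hfin v hv
    obtain ⟨b, hb, hlel⟩ := exists_basis hv h
    obtain ⟨T, hT⟩ := exists_chart hb
    rw [hlel]
    by_contra hcon
    obtain ⟨B, hB⟩ := (logSubharmonic_line hpos husc hhom hpsh hne hb).le_of_not_limsup_lt
      (by norm_num) hcon
    refine hfin.ne (setLIntegral_balanced_eq_top husc hhom T (B := B) fun ζ hζ hζ1 ↦ ?_)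
    simpa [hT, add_comm] using hB ζ hζ hζ1
  · intro H
    refine setLIntegral_lt_top_of_cones fun v hv ↦ ?_
    obtain ⟨b, hb, hlel⟩ := exists_basis hv h
    obtain ⟨T, hT⟩ := exists_chart hb
    have hlt := H v hv
    rw [hlel] at hlt
    obtain ⟨ε, hε, hint⟩ :=
      (logSubharmonic_line hpos husc hhom hpsh hne hb).exists_lintegral_inv_pow_lt_top
        (k := 6) (by norm_num) (by norm_num; exact hlt)
    have hTv : T.symm v = (0, 1) := by
      rw [ContinuousLinearEquiv.symm_apply_eq]; simp [hT]
    refine ⟨{z | ‖(T.symm z).1‖ < ε * ‖(T.symm z).2‖}, isOpen_lt (by fun_prop) (by fun_prop),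
      by simp [hTv, hε], fun r z hr hz ↦ ?_, setLIntegral_cone_lt_top hpos husc hhom T hε ?_⟩
    · have e : T.symm (r • z) = r • T.symm z := by
        rw [← Complex.coe_smul, map_smul, Complex.coe_smul]
      simp only [Set.mem_ofPred_eq, e, Prod.smul_fst, Prod.smul_snd, norm_smul,
        Real.norm_of_nonneg hr.le] at hz
      exact lt_of_mul_lt_mul_left (by linarith) hr.le
    · simpa [hT, add_comm] using hint
end
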